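/- arXiv:2205.11418 — 4 statements merged into one kernel-verified Lean document; each statement's English description precedes it below -/
import Mathlib

section
/- Let n be even with d = gcd(2i, n) = gcd(i, n) < n, and let c ∈ F_{2^d} \ F_2. Then the function G : F_{2^n} → F_{2^n} defined by G(x) = (x + tr(x^{2^i+1}))^{2^i+1} is a permutation of F_{2^n}, and its c-differential uniformity equals 2 (i.e., G is an APcN permutation). -/
/-- The absolute trace from `F_{2^n}` to its prime field, computed inside the field:
`tr(x) = x + x^2 + x^4 + ⋯ + x^{2^{n-1}}` (its values lie in `{0, 1}`). -/
noncomputable def aTr {K : Type} [CommRing K] (n : ℕ) (x : K) : K :=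
  ∑ k ∈ Finset.range n, x ^ 2 ^ k

/-- The `c`-differential uniformity of `F`: the maximum over `a, b` (with `a ≠ 0`
required if `c = 1`) of the number of solutions `x` of `F(x+a) + c·F(x) = b`. -/
noncomputable def cDelta {K : Type} [Field K] (c : K) (F : K → K) : ℕ :=
  sSup { k : ℕ | ∃ a b : K, (c = 1 → a ≠ 0) ∧
    k = Nat.card {x : K // F (x + a) + c * F x = b} }

theorem trace_form_add {K : Type} [Field K] (σ : K →+* K) (T : K →+ K) (x y : K) :
    T (σ (x + y) * (x + y)) =
      T (σ x * x) + T (σ y * y) + T (σ x * y + x * σ y) := by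
  rw [← map_add, ← map_add, map_add σ]
  ring_nf

/-- Completing the norm-like form: the shifted equation becomes pure in `y + γ * e`. -/
theorem map_mul_self_affine {K : Type} [Field K] (σ : K →+* K) {c γ : K}
    (hγ : γ * (1 + c) = 1) (hγσ : σ γ = γ) (y e : K) : σ (y + e) * (y + e) + c * (σ y * y) =
      (1 + c) * (σ (y + γ * e) * (y + γ * e)) + (1 - γ) * (σ e * e) := by
  simp only [map_add, map_mul, hγσ]
  linear_combination (-(y * σ e) - e * σ y - γ * e * σ e) * hγ

section Abstract

variable {K : Type} [Field K] [CharP K 2]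

theorem iterate_eq_of_odd {α : Type*} {f : α → α} {m : ℕ} (hm : Odd m) {x : α}
    (h2 : f (f x) = x) : f^[m] x = f x := by
  obtain ⟨k, rfl⟩ := hm
  have h : Function.IsPeriodicPt f (2 * k) x :=
    Function.IsPeriodicPt.mul_const (m := 2) h2 k
  exact (Function.iterate_succ_apply' f (2 * k) x).trans (congrArg f h.eq)

/-- `x ↦ σ x * x` is injective when the field automorphism `σ` has odd order. -/
theorem map_mul_self_injective (σ : K →+* K) {m : ℕ} (hm : Odd m) (hσ : ∀ x, σ^[m] x = x) :
    Function.Injective (fun x => σ x * x) := by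
  intro x y h
  dsimp only at h
  by_cases hy : y = 0
  · subst hy
    simpa using h
  have hy' : σ y ≠ 0 := by simpa using hy
  have hr : σ (x / y) * (x / y) = 1 := by
    rw [map_div₀]; field_simp; exact h
  have hr1 : σ (x / y) = (x / y)⁻¹ := eq_inv_of_mul_eq_one_left hr
  have h3 := iterate_eq_of_odd (f := σ) hm (x := x / y) (by rw [hr1, map_inv₀, hr1, inv_inv])
  rw [hσ, hr1] at h3
  have hr0 : x / y ≠ 0 := right_ne_zero_of_mul_eq_one hr
  have h4 : (x / y) ^ 2 = 1 := by
    rw [sq]; nth_rewrite 2 [h3]; exact mul_inv_cancel₀ hr0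
  have h5 : (x / y - 1) ^ 2 = 0 := by
    rw [sub_pow_char (p := 2), h4]; simp
  have h6 : x / y = 1 := sub_eq_zero.mp (by simpa using h5)
  exact (div_eq_one_iff_eq hy).mp h6

/-- If `σ` has odd order in characteristic two, then `σ - 1` has trivial kernel on its image. -/
theorem map_add_self_fixed (σ : K →+* K) {m : ℕ} (hm : Odd m) (hσ : ∀ x, σ^[m] x = x)
    {x : K} (h : σ (σ x + x) = σ x + x) : σ x + x = 0 := by
  have h2 : σ (σ x) = x := by
    rw [map_add] at h
    linear_combination h
  have := iterate_eq_of_odd (f := σ) hm h2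
  rw [hσ] at this
  rw [← this, CharTwo.add_self_eq_zero]

/-- Every element is the sum of a fixed point of `σ` and an element of the image of `σ - 1`. -/
theorem exists_fixed_add_map_add_self [Finite K] (σ : K →+* K) {m : ℕ} (hm : Odd m)
    (hσ : ∀ x, σ^[m] x = x) (w : K) : ∃ τ a, σ τ = τ ∧ w = τ + (σ a + a) := by
  let φ : K →+ K := σ.toAddMonoidHom + AddMonoidHom.id K
  have hφ : ∀ x, φ x = σ x + x := fun _ => rfl
  let ψ : φ.range →+ φ.range := φ.rangeRestrict.comp φ.range.subtype
  have hψ : Function.Injective ψ := by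
    rw [injective_iff_map_eq_zero]
    rintro ⟨_, x, rfl⟩ h
    have h' : φ (φ x) = 0 := congrArg Subtype.val h
    rw [hφ, hφ] at h'
    exact Subtype.ext (map_add_self_fixed σ hm hσ (CharTwo.add_eq_zero.mp h'))
  obtain ⟨⟨_, a, rfl⟩, ha⟩ := (Finite.injective_iff_surjective.mp hψ) ⟨φ w, w, rfl⟩
  have ha' : φ (φ a) = φ w := congrArg Subtype.val ha
  refine ⟨w + φ a, a, ?_, ?_⟩
  · have h : φ (w + φ a) = 0 := by rw [map_add, ha', CharTwo.add_self_eq_zero]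
    exact CharTwo.add_eq_zero.mp h
  · rw [← hφ, add_assoc, CharTwo.add_self_eq_zero, add_zero]

/-- If `s ^ 4 = δ s` on the whole image of `σ ^ 2 - 1`, then `σ` is trivial as soon as it fixes an
element outside the prime field. -/
theorem map_eq_self_of_pow_four_eq [Finite K] (σ : K →+* K) {m : ℕ} (hm : Odd m)
    (hσ : ∀ x, σ^[m] x = x) {c δ : K} (hc : σ c = c) (hc0 : c ≠ 0) (hc1 : c ≠ 1)
    (h : ∀ z, (z + σ (σ z)) ^ 4 = δ * (z + σ (σ z))) (x : K) : σ x = x := by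
  have h2 : (2 : K) = 0 := CharTwo.two_eq_zero
  have him : ∀ x, (σ x + x) ^ 4 = δ * (σ x + x) := by
    intro x
    obtain ⟨τ, a, hτ, rfl⟩ := exists_fixed_add_map_add_self σ hm hσ x
    have := h a
    simp only [map_add, hτ]
    have e : τ + (σ (σ a) + σ a) + (τ + (σ a + a)) = a + σ (σ a) := by
      linear_combination (τ + σ a) * h2
    rw [e, this]
  by_contra hx
  set s := σ x + x with hs
  have hs0 : s ≠ 0 := fun h0 => hx (CharTwo.add_eq_zero.mp h0)
  have hsσ : σ s + s ≠ 0 := fun h0 =>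
    hs0 (map_add_self_fixed σ hm hσ (CharTwo.add_eq_zero.mp h0))
  have hs3 : s ^ 3 = δ := mul_right_cancel₀ hs0 (by linear_combination him x)
  have hc3 : c ^ 3 = 1 := by
    have h4 := him (c * x)
    rw [map_mul, hc, ← mul_add, ← hs] at h4
    have : c * s ≠ 0 := mul_ne_zero hc0 hs0
    have h5 : (c * s) ^ 3 = δ := mul_right_cancel₀ this (by linear_combination h4)
    rw [mul_pow, hs3] at h5
    have hδ : δ ≠ 0 := hs3 ▸ pow_ne_zero 3 hs0
    exact mul_right_cancel₀ hδ (by rw [h5, one_mul])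
  have hσs3 : (σ s) ^ 3 = δ := by
    have h4 := him (σ x)
    rw [← map_add, ← hs] at h4
    exact mul_right_cancel₀ (by simpa using hs0 : σ s ≠ 0) (by linear_combination h4)
  have hq : (σ s) ^ 2 + σ s * s + s ^ 2 = 0 := by
    refine (mul_eq_zero.mp (?_ : (σ s + s) * _ = 0)).resolve_left hsσ
    linear_combination hσs3 - hs3 + (s ^ 3 + σ s ^ 2 * s + σ s * s ^ 2) * h2
  have hss : σ (s ^ 2) + s ^ 2 = σ s * s := by
    rw [map_pow]; linear_combination hq - σ s * s * h2
  have h6 := him (s ^ 2)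
  rw [hss] at h6
  have hδ : δ ≠ 0 := hs3 ▸ pow_ne_zero 3 hs0
  have hp : σ s * s ≠ 0 := mul_ne_zero (by simpa using hs0) hs0
  have h7 : (σ s * s) ^ 3 = δ := mul_right_cancel₀ hp (by linear_combination h6)
  rw [mul_pow, hσs3, hs3] at h7
  have hδ1 : δ = 1 := mul_right_cancel₀ hδ (by rw [h7, one_mul])
  have hcq : c ^ 2 + c + 1 = 0 := by
    refine (mul_eq_zero.mp (?_ : (c - 1) * _ = 0)).resolve_left (sub_ne_zero.mpr hc1)
    linear_combination hc3
  have hroots : (s - 1) * ((s - c) * (s - c ^ 2)) = 0 := by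
    linear_combination hs3 + hδ1 + (-s ^ 2 + s * c) * hcq - hc3
  apply hsσ
  rw [CharTwo.add_eq_zero]
  rcases mul_eq_zero.mp hroots with h8 | h8
  · rw [sub_eq_zero.mp h8, map_one]
  rcases mul_eq_zero.mp h8 with h8 | h8
  · rw [sub_eq_zero.mp h8, hc]
  · rw [sub_eq_zero.mp h8, map_pow, hc]

/-- The trace form obtained by eliminating the shift `a` does not vanish identically. -/
theorem exists_trace_form_ne_zero [Finite K] (σ : K →+* K) {m : ℕ} (hm : Odd m)
    (hσ : ∀ x, σ^[m] x = x) (T : K →+ K) (hT2 : ∀ x, T (x ^ 2) = T x)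
    (hTσ : ∀ x, T (σ x) = T x) (hT : ∀ α, (∀ w, T (α * w) = 0) → α = 0)
    {c β : K} (hc : σ c = c) (hc0 : c ≠ 0) (hc1 : c ≠ 1) (hβ : σ β = β) (hβ0 : β ≠ 0)
    (hne : ∃ x, σ x ≠ x) :
    ∃ z, T (β * (σ z ^ 2 * (z + σ (σ z)))) ≠ 0 := by
  by_contra! hcon
  obtain ⟨x, hx⟩ := hne
  have h2 : (2 : K) = 0 := CharTwo.two_eq_zero
  refine hx (map_eq_self_of_pow_four_eq (δ := β⁻¹) σ hm hσ hc hc0 hc1 (fun z => ?_) x)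
  have key : β ^ 2 * (z + σ (σ z)) ^ 4 + β * (z + σ (σ z)) = 0 := by
    refine hT _ fun v => ?_
    obtain ⟨u, rfl⟩ := (Finite.injective_iff_surjective.mp (frobenius_inj K 2)) v
    obtain ⟨w, rfl⟩ := (Finite.injective_iff_surjective.mp σ.injective) u
    have hzw := hcon (z + w)
    have e1 : T (β * (σ z ^ 2 * w)) = T (β ^ 2 * σ (σ z) ^ 4 * σ w ^ 2) := by
      rw [← hTσ, ← hT2]
      simp only [map_mul, map_pow, hβ]
      ring_nf
    have e2 : T (β * (σ z ^ 2 * σ (σ w))) = T (β ^ 2 * z ^ 4 * σ w ^ 2) := by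
      rw [show β * (σ z ^ 2 * σ (σ w)) = σ (β * z ^ 2 * σ w) by
        simp only [map_mul, map_pow, hβ]; ring, hTσ, ← hT2]
      ring_nf
    have e3 : β * (σ (z + w) ^ 2 * (z + w + σ (σ (z + w)))) =
        β * (σ z ^ 2 * (z + σ (σ z))) + β * (σ w ^ 2 * (w + σ (σ w))) +
        (β * (σ z ^ 2 * w) + β * (σ z ^ 2 * σ (σ w)) + β * (z + σ (σ z)) * σ w ^ 2) := by
      simp only [map_add]
      linear_combination β * (σ z * σ w * (z + w + (σ (σ z) + σ (σ w)))) * h2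
    rw [e3] at hzw
    simp only [map_add, hcon, zero_add] at hzw
    rw [e1, e2, ← map_add, ← map_add] at hzw
    rw [frobenius_def, ← hzw]
    congr 1
    linear_combination β ^ 2 * σ w ^ 2 *
      (2 * z ^ 3 * σ (σ z) + 3 * z ^ 2 * σ (σ z) ^ 2 + 2 * z * σ (σ z) ^ 3) * h2
  have k2 := CharTwo.add_eq_zero.mp key
  have : β ^ 2 ≠ 0 := pow_ne_zero 2 hβ0
  apply mul_left_cancel₀ this
  rw [k2]
  field_simp

/-- The involution `x ↦ x + T (σ x * x)`. -/
def twist (σ : K →+* K) (T : K →+ K) (x : K) : K := x + T (σ x * x)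

theorem trace_form_add_trace (σ : K →+* K) (T : K →+ K) (hTσ : ∀ x, T (σ x) = T x)
    (hT01 : ∀ x, T x = 0 ∨ T x = 1) (hT1 : T 1 = 0) (x u : K) :
    T (σ (x + T u) * (x + T u)) = T (σ x * x) := by
  rcases hT01 u with h | h
  · simp [h]
  · rw [h, trace_form_add]
    simp [hTσ, hT1, CharTwo.add_self_eq_zero]

theorem twist_involutive (σ : K →+* K) (T : K →+ K) (hTσ : ∀ x, T (σ x) = T x)
    (hT01 : ∀ x, T x = 0 ∨ T x = 1) (hT1 : T 1 = 0) :
    Function.Involutive (twist σ T) := by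
  intro x
  rw [twist, twist, trace_form_add_trace σ T hTσ hT01 hT1, add_assoc,
    CharTwo.add_self_eq_zero, add_zero]

theorem twist_add (σ : K →+* K) (T : K →+ K) (hTσ : ∀ x, T (σ x) = T x)
    (hT01 : ∀ x, T x = 0 ∨ T x = 1) (hT1 : T 1 = 0) (y a : K) :
    twist σ T (twist σ T y + twist σ T a) = y + a + T (σ y * a + y * σ a) := by
  have e : twist σ T y + twist σ T a = y + a + T (σ y * y + σ a * a) := by
    rw [map_add]; simp only [twist]; ring
  rw [e, twist, trace_form_add_trace σ T hTσ hT01 hT1, trace_form_add, map_add T (σ y * y)]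
  linear_combination (T (σ y * y) + T (σ a * a)) * (CharTwo.two_eq_zero : (2 : K) = 0)

theorem cDelta_twist [Finite K] (σ : K →+* K) {m : ℕ} (hm : Odd m)
    (hσ : ∀ x, σ^[m] x = x) (T : K →+ K) (hT2 : ∀ x, T (x ^ 2) = T x)
    (hTσ : ∀ x, T (σ x) = T x) (hT : ∀ α, (∀ w, T (α * w) = 0) → α = 0)
    (hT01 : ∀ x, T x = 0 ∨ T x = 1) (hT1 : T 1 = 0)
    {c : K} (hc : σ c = c) (hc0 : c ≠ 0) (hc1 : c ≠ 1) (hne : ∃ x, σ x ≠ x) :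
    cDelta c (fun x => σ (twist σ T x) * twist σ T x) = 2 := by
  have h2 : (2 : K) = 0 := CharTwo.two_eq_zero
  have hinv := twist_involutive σ T hTσ hT01 hT1
  have hadd := twist_add σ T hTσ hT01 hT1
  have hc1' : 1 + c ≠ 0 := fun h => hc1 (CharTwo.add_eq_zero.mp h).symm
  obtain ⟨γ, hγ⟩ : ∃ γ, γ * (1 + c) = 1 := ⟨(1 + c)⁻¹, inv_mul_cancel₀ hc1'⟩
  have hγσ : σ γ = γ := by
    have h := congrArg σ hγ
    rw [map_mul, map_add, map_one, hc] at h
    exact mul_right_cancel₀ hc1' (h.trans hγ.symm)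
  have haff := map_mul_self_affine σ hγ hγσ
  have hle : ∀ k ∈ { k : ℕ | ∃ a b : K, (c = 1 → a ≠ 0) ∧ k = Nat.card {x : K //
      σ (twist σ T (x + a)) * twist σ T (x + a) + c * (σ (twist σ T x) * twist σ T x) = b} },
      k ≤ 2 := by
    rintro _ ⟨a, b, -, rfl⟩
    classical
    obtain ⟨a, rfl⟩ := hinv.surjective a
    let f : {x : K // σ (twist σ T (x + twist σ T a)) * twist σ T (x + twist σ T a) +
        c * (σ (twist σ T x) * twist σ T x) = b} → Bool := fun x =>
      decide (T (σ (twist σ T x.1) * a + twist σ T x.1 * σ a) = 0)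
    have hf : Function.Injective f := by
      rintro ⟨x, hx⟩ ⟨x', hx'⟩ h
      obtain ⟨y, rfl⟩ := hinv.surjective x
      obtain ⟨y', rfl⟩ := hinv.surjective x'
      simp only [f, hinv _, decide_eq_decide] at h
      have hL : T (σ y * a + y * σ a) = T (σ y' * a + y' * σ a) := by
        rcases hT01 (σ y * a + y * σ a) with h1 | h1
        · rw [h1, h.mp h1]
        · refine h1.trans ((hT01 _).resolve_left fun h0 => ?_).symm
          rw [h.mpr h0] at h1
          exact zero_ne_one h1
      rw [hadd, hinv, add_assoc, haff] at hx hx'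
      rw [← hx', hL] at hx
      have h3 := map_mul_self_injective σ hm hσ (mul_left_cancel₀ hc1' (add_right_cancel hx))
      simp only [add_right_cancel h3]
    simpa using Nat.card_le_card_of_injective f hf
  refine le_antisymm (csSup_le' hle) ?_
  have hγ0 : γ ≠ 0 := left_ne_zero_of_mul_eq_one hγ
  have hγ1 : 1 - γ ≠ 0 := by
    intro h
    rw [← sub_eq_zero.mp h] at hγ
    apply hc0
    linear_combination hγ
  set δ := γ * (1 - γ) with hδ
  have hδ0 : δ ≠ 0 := mul_ne_zero hγ0 hγ1
  have hδσ : σ δ = δ := by simp [hδ, hγσ]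
  obtain ⟨z, hz⟩ := exists_trace_form_ne_zero (β := δ⁻¹) σ hm hσ T hT2 hTσ hT hc hc0 hc1
    (by rw [map_inv₀, hδσ]) (inv_ne_zero hδ0) hne
  obtain ⟨τ, a, hτ, hw⟩ := exists_fixed_add_map_add_self σ hm hσ (δ⁻¹ * (σ z * z))
  have hLz : T (σ z * a + z * σ a) = 1 := by
    refine (hT01 _).resolve_left ?_
    convert hz using 2
    have e1 : σ (σ a) + a = δ⁻¹ * (σ z * (z + σ (σ z))) := by
      have e2 := congrArg σ hw
      simp only [map_add, map_mul, map_inv₀, hδσ, hτ] at e2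
      linear_combination (-1 : K) * hw - e2 - (τ + σ a) * h2
    rw [map_add, ← hTσ (z * σ a), map_mul σ, ← map_add]
    congr 1
    linear_combination σ z * e1
  have hzz : σ z * z = δ * τ + δ * (σ a + a) := by
    field_simp at hw
    linear_combination hw
  obtain ⟨t, ht⟩ := (Finite.injective_iff_surjective.mp (frobenius_inj K 2)) (δ * τ + δ)
  rw [frobenius_def] at ht
  have htσ : σ t = t := by
    apply frobenius_inj K 2
    rw [frobenius_def, frobenius_def, ← map_pow, ht]
    simp [hδσ, hτ]
  have hfix : ∀ u, σ u = u → T (σ u * a + u * σ a) = 0 := by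
    intro u hu
    rw [map_add, ← hTσ (σ u * a), map_mul, hu, hu, CharTwo.add_self_eq_zero]
  set y₀ := t - γ * a with hy₀
  set y₁ := z - γ * (a + 1) with hy₁
  have hL : ∀ u v, T (σ (u - v) * a + (u - v) * σ a) =
      T (σ u * a + u * σ a) - T (σ v * a + v * σ a) := by
    intro u v
    rw [← map_sub, map_sub σ]
    ring_nf
  have hγa : T (σ (γ * a) * a + γ * a * σ a) = 0 := by
    rw [map_mul, hγσ, mul_right_comm γ a, CharTwo.add_self_eq_zero, map_zero]
  have hL₀ : T (σ y₀ * a + y₀ * σ a) = 0 := by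
    rw [hL, hfix t htσ, hγa, sub_zero]
  have hL₁ : T (σ y₁ * a + y₁ * σ a) = 1 := by
    rw [hy₁, mul_add, mul_one, ← sub_sub, hL, hL, hLz, hγa, hfix γ hγσ, sub_zero, sub_zero]
  have hy : y₀ ≠ y₁ := by
    intro h
    rw [h, hL₁] at hL₀
    exact one_ne_zero hL₀
  set b := (1 + c) * (σ t * t) + (1 - γ) * (σ a * a) with hb
  have hsol₀ : σ (y₀ + a) * (y₀ + a) + c * (σ y₀ * y₀) = b := by
    rw [haff, hy₀, sub_add_cancel]
  have hsol₁ : σ (y₁ + (a + 1)) * (y₁ + (a + 1)) + c * (σ y₁ * y₁) = b := by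
    rw [haff, hy₁, sub_add_cancel, hb, htσ, map_add, map_one, hzz]
    have : (1 + c) * δ = 1 - γ := by rw [hδ]; linear_combination (1 - γ) * hγ
    linear_combination (-(1 + c)) * ht + (σ a + a - 1) * this + (1 - γ) * (σ a + a) * h2
  have hmem : Nat.card {x : K // σ (twist σ T (x + twist σ T a)) *
      twist σ T (x + twist σ T a) + c * (σ (twist σ T x) * twist σ T x) = b} ∈
      { k : ℕ | ∃ a b : K, (c = 1 → a ≠ 0) ∧ k = Nat.card {x : K //
      σ (twist σ T (x + a)) * twist σ T (x + a) + c * (σ (twist σ T x) * twist σ T x) = b} } :=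
    ⟨_, _, fun h => absurd h hc1, rfl⟩
  refine le_trans ?_ (le_csSup ⟨2, hle⟩ hmem)
  have : Nontrivial {x : K // σ (twist σ T (x + twist σ T a)) *
      twist σ T (x + twist σ T a) + c * (σ (twist σ T x) * twist σ T x) = b} := by
    refine ⟨⟨twist σ T y₀, ?_⟩, ⟨twist σ T y₁, ?_⟩, fun h => hy ?_⟩
    · rw [hadd, hinv, hL₀, add_zero, hsol₀]
    · rw [hadd, hinv, hL₁, add_assoc, hsol₁]
    · exact hinv.injective (congrArg Subtype.val h)
  exact Finite.one_lt_card

end Abstract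

section Galois

variable {n : ℕ}

theorem galoisField_pow_card (hn : n ≠ 0) (x : GaloisField 2 n) : x ^ 2 ^ n = x := by
  have := Fintype.ofFinite (GaloisField 2 n)
  rw [← GaloisField.card 2 n hn, Nat.card_eq_fintype_card, FiniteField.pow_card]

/-- The absolute trace as an additive map. -/
noncomputable def aTrHom (n : ℕ) : GaloisField 2 n →+ GaloisField 2 n where
  toFun := aTr n
  map_zero' := by simp [aTr]
  map_add' x y := by simp [aTr, add_pow_char_pow, Finset.sum_add_distrib]

theorem aTr_sq (hn : n ≠ 0) (x : GaloisField 2 n) : aTr n (x ^ 2) = aTr n x := by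
  have h := Finset.sum_range_succ' (fun k => x ^ 2 ^ k) n
  rw [Finset.sum_range_succ, galoisField_pow_card hn, pow_zero, pow_one] at h
  rw [aTr, aTr, add_right_cancel h]
  exact Finset.sum_congr rfl fun k _ => by rw [← pow_mul, pow_succ']

theorem aTr_pow_two_pow (hn : n ≠ 0) (i : ℕ) (x : GaloisField 2 n) :
    aTr n (x ^ 2 ^ i) = aTr n x := by
  induction i with
  | zero => simp
  | succ i ih => rw [pow_succ, pow_mul, aTr_sq hn, ih]

theorem aTr_eq_zero_or_one (hn : n ≠ 0) (x : GaloisField 2 n) : aTr n x = 0 ∨ aTr n x = 1 := by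
  have h : aTr n x ^ 2 = aTr n x := by
    conv_rhs => rw [← aTr_sq hn]
    rw [aTr, aTr, sum_pow_char 2]
    exact Finset.sum_congr rfl fun k _ => pow_right_comm _ _ _
  rcases eq_or_ne (aTr n x) 0 with h0 | h0
  · exact Or.inl h0
  · exact Or.inr (mul_right_cancel₀ h0 (by rw [← sq, h, one_mul]))

theorem eq_zero_of_aTr_mul_eq_zero (hn : n ≠ 0) {α : GaloisField 2 n}
    (h : ∀ w, aTr n (α * w) = 0) : α = 0 := by
  refine (traceForm_nondegenerate (ZMod 2) (GaloisField 2 n)).1 α fun w => ?_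
  rw [Algebra.traceForm_apply]
  apply (algebraMap (ZMod 2) (GaloisField 2 n)).injective
  rw [FiniteField.algebraMap_trace_eq_sum_pow, GaloisField.finrank 2 hn, Nat.card_zmod, map_zero]
  exact h w

theorem exists_pow_two_pow_ne {i : ℕ} (hn : n ≠ 0) (h : i.gcd n < n) :
    ∃ x : GaloisField 2 n, x ^ 2 ^ i ≠ x := by
  by_contra! hx
  have h1 : FiniteField.frobeniusAlgHom (ZMod 2) (GaloisField 2 n) ^ i = 1 := by
    ext x
    rw [AlgHom.coe_pow, FiniteField.coe_frobeniusAlgHom, pow_iterate, Fintype.card_eq_nat_card,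
      Nat.card_zmod]
    exact hx x
  have h2 := orderOf_dvd_of_pow_eq_one h1
  rw [FiniteField.orderOf_frobeniusAlgHom, GaloisField.finrank 2 hn] at h2
  rw [Nat.gcd_eq_right h2] at h
  exact lt_irrefl _ h

end Galois

/-- for even `n` with `d = gcd(2i,n) = gcd(i,n) < n` and
`c ∈ F_{2^d} \ F_2`, the map `G(x) = (x + tr(x^{2^i+1}))^{2^i+1}` is an APcN
permutation of `F_{2^n}`. -/
theorem stmt0 (n i d : ℕ) (hne : Even n) (hd2 : d = Nat.gcd (2 * i) n)
    (hd1 : d = Nat.gcd i n) (hdn : d < n)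
    (c : GaloisField 2 n) (hc : c ^ 2 ^ d = c) (hc0 : c ≠ 0) (hc1 : c ≠ 1) :
    Function.Bijective
      (fun x : GaloisField 2 n => (x + aTr n (x ^ (2 ^ i + 1))) ^ (2 ^ i + 1)) ∧
    cDelta c
      (fun x : GaloisField 2 n => (x + aTr n (x ^ (2 ^ i + 1))) ^ (2 ^ i + 1)) = 2 := by
  have hn : n ≠ 0 := by lia
  let σ := iterateFrobenius (GaloisField 2 n) 2 i
  let T := aTrHom n
  have hσdef : ∀ x, σ x = x ^ 2 ^ i := iterateFrobenius_def 2 i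
  have hσiter : ∀ k x, σ^[k] x = x ^ 2 ^ (i * k) := by
    intro k x
    induction k with
    | zero => simp
    | succ k ih =>
      rw [Function.iterate_succ_apply', ih, hσdef, ← pow_mul, ← pow_add, Nat.mul_succ]
  have hfix : ∀ (y : GaloisField 2 n) (e k : ℕ), y ^ 2 ^ e = y → y ^ 2 ^ (e * k) = y := by
    intro y e k h
    induction k with
    | zero => simp
    | succ k ih => rw [Nat.mul_succ, pow_add, pow_mul, ih, h]
  have hd0 : 0 < d := hd1 ▸ Nat.gcd_pos_of_pos_right i (Nat.pos_of_ne_zero hn)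
  obtain ⟨m, hm⟩ : d ∣ n := hd1 ▸ Nat.gcd_dvd_right i n
  obtain ⟨j, hj⟩ : d ∣ i := hd1 ▸ Nat.gcd_dvd_left i n
  have hmodd : Odd m := by
    by_contra hme
    obtain ⟨k, hk⟩ := even_iff_two_dvd.mp (Nat.not_odd_iff_even.mp hme)
    have h : 2 * d ∣ d := by
      conv_rhs => rw [hd2]
      refine Nat.dvd_gcd (mul_dvd_mul_left 2 ⟨j, hj⟩) ⟨k, ?_⟩
      rw [hm, hk]; ring
    have := Nat.le_of_dvd hd0 h
    lia
  have hσm : ∀ x, σ^[m] x = x := by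
    intro x
    rw [hσiter, show i * m = n * j by rw [hm, hj]; ring]
    exact hfix x n j (galoisField_pow_card hn x)
  have hσc : σ c = c := by
    rw [hσdef, hj]
    exact hfix c d j hc
  have hTσ : ∀ x, T (σ x) = T x := fun x => by
    rw [hσdef]; exact aTr_pow_two_pow hn i x
  have hT01 : ∀ x, T x = 0 ∨ T x = 1 := aTr_eq_zero_or_one hn
  have hT1 : T 1 = 0 := by
    change aTr n 1 = 0
    obtain ⟨k, rfl⟩ := hne
    simp [aTr, CharTwo.add_self_eq_zero]
  have hG : (fun x : GaloisField 2 n => (x + aTr n (x ^ (2 ^ i + 1))) ^ (2 ^ i + 1)) =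
      fun x => σ (twist σ T x) * twist σ T x := by
    funext x
    simp only [twist, hσdef, ← pow_succ]
    rfl
  rw [hG]
  refine ⟨Finite.injective_iff_bijective.mp ?_, ?_⟩
  · exact (map_mul_self_injective σ hmodd hσm).comp
      (twist_involutive σ T hTσ hT01 hT1).injective
  · exact cDelta_twist σ hmodd hσm T (aTr_sq hn) hTσ
      (fun α h => eq_zero_of_aTr_mul_eq_zero hn h) hT01 hT1 hσc hc0 hc1
      (exists_pow_two_pow_ne hn (hd1 ▸ hdn))
end

section
/- Let c ∈ F_{2^d} \ F_2 with d = gcd(2i, n) = gcd(i, n) < n, and let n = dm be even. Then there exist w ∈ F_{2^n}^× and z ∈ F_{2^n} satisfying simultaneously: (i) tr^n_d(z/c) = 1, (ii) tr^n_d(z/w^{2^i+1}) = 1, and (iii) tr( z(w + w^{2^i}) / (c(c+1)) ) = 1. -/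
/-- The relative trace `tr^n_d : F_{2^n} → F_{2^d}` (with `n = d*m`). -/
noncomputable def relTr {K : Type} [CommRing K] (d m : ℕ) (x : K) : K :=
  ∑ k ∈ Finset.range m, x ^ 2 ^ (d * k)

open Algebra Module

/-- Linearly independent elements of a finite separable extension have arbitrary simultaneous
trace pairings with a suitable element. -/
theorem exists_trace_mul_eq {L K ι : Type*} [Field L] [Field K] [Algebra L K]
    [FiniteDimensional L K] [Algebra.IsSeparable L K] {v : ι → K} (hv : LinearIndependent L v)
    (t : ι → L) : ∃ z : K, ∀ j, trace L K (z * v j) = t j := by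
  obtain ⟨g, hg⟩ := LinearMap.exists_extend ((Basis.span hv).constr L t)
  have hB := traceForm_nondegenerate L K
  refine ⟨((traceForm L K).toDual hB).symm g, fun j ↦ ?_⟩
  have hz := LinearMap.BilinForm.apply_toDual_symm_apply (hB := hB) g (v j)
  rw [traceForm_apply] at hz
  rw [hz]
  have h := LinearMap.congr_fun hg (Basis.span hv j)
  rwa [Basis.constr_basis, LinearMap.comp_apply, Submodule.subtype_apply,
    Basis.span_apply] at h

theorem trace_zmod_two_sq {L : Type*} [Field L] [Finite L] [Algebra (ZMod 2) L] (x : L) :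
    trace (ZMod 2) L (x ^ 2) = trace (ZMod 2) L x := by
  simpa using trace_eq_of_algEquiv (FiniteField.frobeniusAlgEquivOfAlgebraic (ZMod 2) L) x

/-- A form `x ↦ tr (α x + β x ^ 3)` with `α ≠ 0` is not identically zero, provided `tr 1 = 0`. -/
theorem exists_trace_linear_add_cube_eq_one {L : Type*} [Field L] [Finite L] [Algebra (ZMod 2) L]
    (h1 : trace (ZMod 2) L 1 = 0) {α : L} (hα : α ≠ 0) (β : L) :
    ∃ x : L, trace (ZMod 2) L (α * x + β * x ^ 3) = 1 := by
  by_contra! hcon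
  have : CharP L 2 := charP_of_injective_algebraMap (algebraMap (ZMod 2) L).injective 2
  have htwo : (2 : L) = 0 := CharTwo.two_eq_zero
  have hzero (x : L) : trace (ZMod 2) L (α * x + β * x ^ 3) = 0 := by
    have h := hcon x
    generalize trace (ZMod 2) L (α * x + β * x ^ 3) = t at h
    revert t; decide
  have hnondeg (a : L) (ha : ∀ y, trace (ZMod 2) L (a * y) = 0) : a = 0 :=
    (traceForm_nondegenerate (ZMod 2) L).1 a ha
  have hpolar (x y : L) : trace (ZMod 2) L ((β ^ 2 * x ^ 4 + β * x) * y ^ 2) = 0 := by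
    have hsplit : (α * (x + y) + β * (x + y) ^ 3) = (α * x + β * x ^ 3) + (α * y + β * y ^ 3) +
        (β * x ^ 2 * y + β * x * y ^ 2) := by
      linear_combination (β * x ^ 2 * y + β * x * y ^ 2) * htwo
    have h := hzero (x + y)
    rw [hsplit, map_add, map_add, hzero, hzero, zero_add, zero_add, map_add,
      ← trace_zmod_two_sq (β * x ^ 2 * y), ← map_add] at h
    rw [← h]
    congr 1
    ring
  have hcube (x : L) : β ^ 2 * x ^ 4 + β * x = 0 := by
    refine hnondeg _ fun y ↦ ?_
    obtain ⟨s, rfl⟩ := (FiniteField.frobeniusAlgEquivOfAlgebraic (ZMod 2) L).surjective y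
    simpa using hpolar x s
  refine hα (hnondeg α fun x ↦ ?_)
  have hx := hzero x
  rw [map_add] at hx
  have hsq : (β * x ^ 3) * (β * x ^ 3) = β * x ^ 3 := by
    linear_combination x ^ 2 * hcube x - β * x ^ 3 * htwo
  have htr : trace (ZMod 2) L (β * x ^ 3) = 0 := by
    rcases IsIdempotentElem.iff_eq_zero_or_one.mp hsq with h | h <;> simp [h, h1]
  simpa [htr] using hx

section

variable {L K : Type*} [Field L] [Field K] [Algebra L K] {σ : K →ₐ[L] K}

theorem linearIndependent_one_inv_mul_map
    (hσ : ∀ x, σ (σ x) = x → x ∈ Set.range (algebraMap L K)) {w : K}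
    (hw : w ∉ Set.range (algebraMap L K)) :
    LinearIndependent L ![1, (w * σ w)⁻¹] := by
  have hw0 : w ≠ 0 := by rintro rfl; exact hw ⟨0, map_zero _⟩
  have hσw : σ w ≠ 0 := by simpa using hw0
  rw [LinearIndependent.pair_iff]
  intro s t h
  rw [Algebra.smul_def, Algebra.smul_def] at h
  have ht : t = 0 := by
    by_contra ht
    have ht' : algebraMap L K t ≠ 0 := by simpa using ht
    have hs' : algebraMap L K s ≠ 0 := by
      intro hs
      simp [hs, ht, hw0] at h
    have h' : algebraMap L K s * (w * σ w) + algebraMap L K t = 0 := by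
      field_simp at h
      linear_combination h
    have h'' := congrArg σ h'
    simp only [map_add, map_mul, AlgHom.commutes, map_zero] at h''
    refine hw (hσ w (mul_left_cancel₀ (mul_ne_zero hs' hσw) ?_))
    linear_combination h'' - h'
  subst ht
  simpa using h

theorem linearIndependent_one_inv_mul_map_add_map [CharP K 2]
    (hσ : ∀ x, σ (σ x) = x → x ∈ Set.range (algebraMap L K)) {w : K}
    (hw : σ (σ (σ w)) ≠ w) :
    LinearIndependent L ![1, (w * σ w)⁻¹, w + σ w] := by
  have htwo : (2 : K) = 0 := CharTwo.two_eq_zero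
  have hwL : w ∉ Set.range (algebraMap L K) := by rintro ⟨a, rfl⟩; simp at hw
  have hw0 : w ≠ 0 := by rintro rfl; simp at hw
  have hσw : σ w ≠ 0 := by simpa using hw0
  have hpair := LinearIndependent.pair_iff.mp (linearIndependent_one_inv_mul_map hσ hwL)
  rw [Fintype.linearIndependent_iff]
  intro g hg
  simp only [Fin.sum_univ_three, Matrix.cons_val] at hg
  have h2 : g 2 = 0 := by
    by_contra h2
    obtain ⟨a, ha⟩ : ∃ a, a = g 0 / g 2 := ⟨_, rfl⟩
    obtain ⟨b, hb⟩ : ∃ b, b = g 1 / g 2 := ⟨_, rfl⟩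
    have hab : algebraMap L K a + algebraMap L K b * (w * σ w)⁻¹ + (w + σ w) = 0 := by
      have h2' : algebraMap L K (g 2) ≠ 0 := by simpa using h2
      simp only [Algebra.smul_def] at hg
      rw [ha, hb, map_div₀, map_div₀]
      field_simp at hg ⊢
      linear_combination hg
    have h' : algebraMap L K b + w * σ w * (w + σ w + algebraMap L K a) = 0 := by
      field_simp at hab
      linear_combination hab
    have h'' := congrArg σ h'
    simp only [map_add, map_mul, AlgHom.commutes, map_zero] at h''
    have hprod : σ w * ((w - σ (σ w)) * (w + σ w + σ (σ w) + algebraMap L K a)) = 0 := by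
      linear_combination h' - h''
    rcases mul_eq_zero.mp ((mul_eq_zero.mp hprod).resolve_left hσw) with h | h
    · exact hwL (hσ w (sub_eq_zero.mp h).symm)
    · have hs := congrArg σ h
      simp only [map_add, AlgHom.commutes, map_zero] at hs
      exact hw (by linear_combination hs - h)
  have h01 := hpair (g 0) (g 1) (by simpa [h2] using hg)
  intro j
  fin_cases j
  exacts [h01.1, h01.2, h2]

/-- If `σ` has order three, then `w + σ w` is an explicit combination of `1` and
`(w * σ w)⁻¹`. -/
theorem add_map_eq_of_map_map_map [CharP K 2]
    (hσ : ∀ x, σ x = x → x ∈ Set.range (algebraMap L K))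
    (h3 : ∀ x, σ (σ (σ x)) = x) (hne : ∃ w, w ∉ Set.range (algebraMap L K)) :
    ∃ (w : K) (a b : L), w ∉ Set.range (algebraMap L K) ∧ a ≠ 0 ∧
      w + σ w = algebraMap L K a + algebraMap L K b * (w * σ w)⁻¹ := by
  have htwo : (2 : K) = 0 := CharTwo.two_eq_zero
  have haux (w : K) : ∃ a, algebraMap L K a = w + σ w + σ (σ w) :=
    hσ _ (by simp only [map_add, h3]; ring)
  obtain ⟨w, hw, a, ha0, ha⟩ : ∃ w, w ∉ Set.range (algebraMap L K) ∧
      ∃ a, a ≠ 0 ∧ algebraMap L K a = w + σ w + σ (σ w) := by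
    obtain ⟨w, hw⟩ := hne
    obtain ⟨a, ha⟩ := haux w
    by_cases ha0 : a = 0
    · refine ⟨w + 1, ?_, 1, one_ne_zero, ?_⟩
      · rintro ⟨y, hy⟩
        exact hw ⟨y - 1, by rw [map_sub, hy, map_one]; ring⟩
      · subst ha0
        simp only [map_add, map_one, map_zero] at ha ⊢
        linear_combination ha - htwo
    · exact ⟨w, hw, a, ha0, ha⟩
  obtain ⟨b, hb⟩ := hσ (w * σ w * σ (σ w)) (by simp only [map_mul, h3]; ring)
  have hw0 : w ≠ 0 := by rintro rfl; exact hw ⟨0, map_zero _⟩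
  have hσw : σ w ≠ 0 := by simpa using hw0
  refine ⟨w, a, b, hw, ha0, ?_⟩
  rw [ha, hb]
  field_simp
  linear_combination - σ (σ w) * htwo

/-- The existence statement for an arbitrary extension `K / L` of finite fields of
characteristic two, in terms of an automorphism `σ` such that `σ ^ 2` has fixed field `L`. -/
theorem exists_trace_eq_one_of_algHom [Algebra (ZMod 2) L] [Algebra (ZMod 2) K]
    [IsScalarTower (ZMod 2) L K] [Finite K]
    (hσ : ∀ x, σ (σ x) = x → x ∈ Set.range (algebraMap L K))
    (hne : ∃ w, w ∉ Set.range (algebraMap L K)) (h1 : trace (ZMod 2) L 1 = 0)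
    {c : L} (hc0 : c ≠ 0) (hc1 : c ≠ 1) :
    ∃ w z : K, w ≠ 0 ∧ trace L K (z / algebraMap L K c) = 1 ∧
      trace L K (z / (w * σ w)) = 1 ∧
      trace (ZMod 2) K
        (z * (w + σ w) / (algebraMap L K c * (algebraMap L K c + 1))) = 1 := by
  have : Finite L := Finite.of_injective _ (algebraMap L K).injective
  have : CharP K 2 := charP_of_injective_algebraMap (algebraMap (ZMod 2) K).injective 2
  have : CharP L 2 := charP_of_injective_algebraMap (algebraMap (ZMod 2) L).injective 2
  have hc1' : c + 1 ≠ 0 := by rwa [Ne, CharTwo.add_eq_zero]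
  have hfirst {z : K} (hz : trace L K z = c) : trace L K (z / algebraMap L K c) = 1 := by
    rw [div_eq_inv_mul, ← map_inv₀, ← Algebra.smul_def, map_smul, hz, smul_eq_mul,
      inv_mul_cancel₀ hc0]
  have hthird (y : K) : trace (ZMod 2) K
      (y / (algebraMap L K c * (algebraMap L K c + 1))) =
      trace (ZMod 2) L ((c * (c + 1))⁻¹ * trace L K y) := by
    rw [← trace_trace (S := L), div_eq_inv_mul, ← map_one (algebraMap L K), ← map_add,
      ← map_mul, ← map_inv₀, ← Algebra.smul_def, map_smul, smul_eq_mul]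
  by_cases h3 : ∀ x, σ (σ (σ x)) = x
  · obtain ⟨w, a, b, hw, ha, hab⟩ :=
      add_map_eq_of_map_map_map (fun x hx ↦ hσ x (by rw [hx, hx])) h3 hne
    obtain ⟨r, hr⟩ := exists_trace_linear_add_cube_eq_one h1
      (div_ne_zero ha hc1') (b / (c * (c + 1)))
    have hr0 : r ≠ 0 := by rintro rfl; simp at hr
    have hr0' : algebraMap L K r ≠ 0 := by simpa using hr0
    have hw0 : w ≠ 0 := by rintro rfl; exact hw ⟨0, map_zero _⟩
    have hσw : σ w ≠ 0 := by simpa using hw0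
    have hrw : algebraMap L K r * w ∉ Set.range (algebraMap L K) := by
      rintro ⟨y, hy⟩
      exact hw ⟨y / r, by rw [map_div₀, hy]; field_simp⟩
    obtain ⟨z, hz⟩ := exists_trace_mul_eq (linearIndependent_one_inv_mul_map hσ hrw) ![c, 1]
    have hz0 := hz 0
    have hz1 := hz 1
    simp only [Matrix.cons_val, mul_one] at hz0 hz1
    refine ⟨algebraMap L K r * w, z, mul_ne_zero hr0' hw0, hfirst hz0, by
      rwa [div_eq_mul_inv], ?_⟩
    have hsum : z * (algebraMap L K r * w + σ (algebraMap L K r * w)) =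
        (r * a) • z +
          (r ^ 3 * b) • (z * (algebraMap L K r * w * σ (algebraMap L K r * w))⁻¹) := by
      simp only [Algebra.smul_def, map_mul, map_pow, AlgHom.commutes]
      rw [← mul_add, hab]
      field_simp
    rw [hthird, hsum, map_add, map_smul, map_smul, hz0, hz1, ← hr, smul_eq_mul, smul_eq_mul]
    congr 1
    field_simp
  · push Not at h3
    obtain ⟨w, hw⟩ := h3
    have hw0 : w ≠ 0 := by rintro rfl; simp at hw
    obtain ⟨s, hs⟩ := trace_surjective (ZMod 2) L 1
    obtain ⟨z, hz⟩ := exists_trace_mul_eq (linearIndependent_one_inv_mul_map_add_map hσ hw)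
      ![c, 1, c * (c + 1) * s]
    have hz0 := hz 0
    have hz1 := hz 1
    have hz2 := hz 2
    simp only [Matrix.cons_val, mul_one] at hz0 hz1 hz2
    refine ⟨w, z, hw0, hfirst hz0, by rwa [div_eq_mul_inv], ?_⟩
    rw [hthird, hz2, inv_mul_cancel_left₀ (mul_ne_zero hc0 hc1'), hs]

end

theorem pow_two_pow_gcd_eq_self {M : Type*} [Monoid M] {x : M} {a b : ℕ}
    (ha : x ^ 2 ^ a = x) (hb : x ^ 2 ^ b = x) : x ^ 2 ^ Nat.gcd a b = x := by
  have hiter (k : ℕ) : Function.IsPeriodicPt (fun y : M ↦ y ^ 2) k x ↔ x ^ 2 ^ k = x := by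
    rw [Function.IsPeriodicPt, Function.IsFixedPt, pow_iterate]
  exact (hiter _).mp (((hiter a).mpr ha).gcd ((hiter b).mpr hb))

/-- In an extension of a finite field `L`, the roots of `X ^ #L - X` all lie in `L`. -/
theorem FiniteField.mem_range_algebraMap_of_pow_card_eq_self {L K : Type*} [Field L] [Finite L]
    [Field K] [Algebra L K] {x : K} (hx : x ^ Nat.card L = x) :
    x ∈ Set.range (algebraMap L K) := by
  have := Fintype.ofFinite L
  rw [Nat.card_eq_fintype_card] at hx
  have hmem : x ∈ ((Polynomial.X ^ Fintype.card L - Polynomial.X : Polynomial L).map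
      (algebraMap L K)).roots := by
    simp [hx, FiniteField.X_pow_card_sub_X_ne_zero K Fintype.one_lt_card]
  have hsplits := Polynomial.splits_X_pow_nat_card_sub_X (K := L)
  rw [Nat.card_eq_fintype_card] at hsplits
  rw [hsplits.roots_map, FiniteField.roots_X_pow_card_sub_X, Multiset.mem_map] at hmem
  obtain ⟨y, -, hy⟩ := hmem
  exact ⟨y, hy⟩

/-- with `c ∈ F_{2^d} \ F_2`, `d = gcd(2i,n) = gcd(i,n) < n` and
`n = dm` even, there exist `w ∈ F_{2^n}^×` and `z ∈ F_{2^n}` with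
`tr^n_d(z/c) = 1`, `tr^n_d(z/w^{2^i+1}) = 1` and `tr(z(w+w^{2^i})/(c(c+1))) = 1`. -/
theorem stmt10 (n i d m : ℕ) (hnm : n = d * m) (hne : Even n)
    (hd2 : d = Nat.gcd (2 * i) n) (hd1 : d = Nat.gcd i n) (hdn : d < n)
    (c : GaloisField 2 n) (hc : c ^ 2 ^ d = c) (hc0 : c ≠ 0) (hc1 : c ≠ 1) :
    ∃ w z : GaloisField 2 n, w ≠ 0 ∧
      relTr d m (z / c) = 1 ∧
      relTr d m (z / w ^ (2 ^ i + 1)) = 1 ∧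
      aTr n (z * (w + w ^ 2 ^ i) / (c * (c + 1))) = 1 := by
  have hn0 : n ≠ 0 := by omega
  have hd0 : d ≠ 0 := by rintro rfl; simp [hn0] at hnm
  have hmul : d ∣ n := ⟨m, hnm⟩
  have hdi : d ∣ i := hd1 ▸ Nat.gcd_dvd_left i n
  have hd : Even d := by
    rcases Nat.even_mul.mp (hnm ▸ hne) with h | h
    · exact h
    · obtain ⟨k, hk⟩ := h.two_dvd
      have h2d : 2 * d ∣ d := by
        conv_rhs => rw [hd2]
        exact Nat.dvd_gcd (Nat.mul_dvd_mul_left 2 hdi) ⟨k, by rw [hnm, hk]; ring⟩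
      have := Nat.le_of_dvd (Nat.pos_of_ne_zero hd0) h2d
      omega
  obtain ⟨f⟩ := FiniteField.nonempty_algHom_of_finrank_dvd (F := ZMod 2)
    (K := GaloisField 2 d) (L := GaloisField 2 n)
    (by rwa [GaloisField.finrank 2 hd0, GaloisField.finrank 2 hn0])
  let : Algebra (GaloisField 2 d) (GaloisField 2 n) := f.toRingHom.toAlgebra
  have : IsScalarTower (ZMod 2) (GaloisField 2 d) (GaloisField 2 n) :=
    IsScalarTower.of_algebraMap_eq fun x ↦ (f.commutes x).symm
  have hcardL : Nat.card (GaloisField 2 d) = 2 ^ d := GaloisField.card 2 d hd0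
  have hcardK : Nat.card (GaloisField 2 n) = 2 ^ n := GaloisField.card 2 n hn0
  have hfin : finrank (GaloisField 2 d) (GaloisField 2 n) = m := by
    have h := Module.finrank_mul_finrank (ZMod 2) (GaloisField 2 d) (GaloisField 2 n)
    rw [GaloisField.finrank 2 hd0, GaloisField.finrank 2 hn0] at h
    exact Nat.eq_of_mul_eq_mul_left (Nat.pos_of_ne_zero hd0) (h.trans hnm)
  have hrel (x : GaloisField 2 n) : relTr d m x =
      algebraMap _ _ (trace (GaloisField 2 d) (GaloisField 2 n) x) := by
    rw [FiniteField.algebraMap_trace_eq_sum_pow, hfin, hcardL, relTr]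
    simp only [pow_mul]
  have habs (x : GaloisField 2 n) : aTr n x =
      algebraMap _ _ (trace (ZMod 2) (GaloisField 2 n) x) := by
    rw [FiniteField.algebraMap_trace_eq_sum_pow, GaloisField.finrank 2 hn0, Nat.card_zmod, aTr]
  have hrange {x : GaloisField 2 n} (hx : x ^ 2 ^ d = x) :
      x ∈ Set.range (algebraMap (GaloisField 2 d) (GaloisField 2 n)) :=
    FiniteField.mem_range_algebraMap_of_pow_card_eq_self (by rwa [hcardL])
  have hpown (x : GaloisField 2 n) : x ^ 2 ^ n = x := by
    have := Fintype.ofFinite (GaloisField 2 n)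
    rw [← hcardK, Nat.card_eq_fintype_card, FiniteField.pow_card]
  obtain ⟨k, hk⟩ := hdi
  have hfix (x : GaloisField 2 d) : x ^ 2 ^ i = x := by
    have := Fintype.ofFinite (GaloisField 2 d)
    rw [hk, pow_mul, ← hcardL, Nat.card_eq_fintype_card, FiniteField.pow_card_pow]
  let σ : GaloisField 2 n →ₐ[GaloisField 2 d] GaloisField 2 n :=
    { iterateFrobenius (GaloisField 2 n) 2 i with
      commutes' := fun x ↦ by
        change algebraMap _ _ x ^ 2 ^ i = _
        rw [← map_pow, hfix] }
  have hσ_apply (x : GaloisField 2 n) : σ x = x ^ 2 ^ i := rfl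
  obtain ⟨c, rfl⟩ := hrange hc
  have hσ (x : GaloisField 2 n) (hx : σ (σ x) = x) :
      x ∈ Set.range (algebraMap (GaloisField 2 d) (GaloisField 2 n)) := by
    rw [hσ_apply, hσ_apply, ← pow_mul, ← pow_add, ← two_mul] at hx
    apply hrange
    have h := pow_two_pow_gcd_eq_self hx (hpown x)
    rwa [← hd2] at h
  have hproper : ∃ w, w ∉ Set.range (algebraMap (GaloisField 2 d) (GaloisField 2 n)) := by
    by_contra! hall
    have h := Nat.card_le_card_of_surjective _ hall
    rw [hcardL, hcardK] at h
    exact absurd h (not_le.mpr (Nat.pow_lt_pow_right one_lt_two hdn))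
  have htrace_one : trace (ZMod 2) (GaloisField 2 d) 1 = 0 := by
    have h := trace_algebraMap (S := GaloisField 2 d) (1 : ZMod 2)
    rw [map_one, GaloisField.finrank 2 hd0, nsmul_one] at h
    rw [h, ZMod.natCast_eq_zero_iff]
    exact hd.two_dvd
  obtain ⟨w, z, hw, h₁, h₂, h₃⟩ := exists_trace_eq_one_of_algHom hσ hproper htrace_one
    (c := c) (by simpa using hc0) (by simpa using hc1)
  refine ⟨w, z, hw, ?_, ?_, ?_⟩
  · rw [hrel, h₁, map_one]
  · rw [pow_succ', ← hσ_apply, hrel, h₂, map_one]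
  · rw [← hσ_apply, habs, h₃, map_one]
end

section
/- Let c ∈ F_{2^d} \ F_2 with d = gcd(2i, n) = gcd(i, n) < n, and let n = dm be even. For a ∈ F_{2^n} define f_a(x) = (x+a)^{2^i+1} + c·x^{2^i+1}. Then there exist x, y, a ∈ F_{2^n} such that f_a(x) = f_{a+1}(y) and tr( (c+1)(x^{2^i+1} + y^{2^i+1}) ) = 1. -/
section TraceForm

variable {K : Type*} [Field K] [Algebra (ZMod 2) K]

local notation "Tr" => Algebra.trace (ZMod 2) K

theorem two_eq_zero_of_algebra_zmod_two : (2 : K) = 0 := by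
  rw [← map_ofNat (algebraMap (ZMod 2) K) 2, show (OfNat.ofNat 2 : ZMod 2) = 0 from rfl, map_zero]

theorem trace_mul_add_map_eq_zero (σ : K ≃ₐ[ZMod 2] K) {z : K} (hz : σ z = z) (y : K) :
    Tr (z * (y + σ y)) = 0 := by
  have h : Tr (z * σ y) = Tr (z * y) := by
    rw [← Algebra.trace_eq_of_algEquiv σ (z * y), map_mul σ, hz]
  rw [mul_add, map_add, h, CharTwo.add_self_eq_zero]

/-- Reduction of the nonlinear system to a system that is linear in `b` and `y`. -/
theorem exists_collision_of_linear_system (σ : K ≃ₐ[ZMod 2] K) (h1 : Tr (1 : K) = 0)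
    {c : K} (hc : σ c = c) {w b y : K}
    (hb : w * σ b + σ w * b = c * (y + σ y + 1) + (1 + c) * (w * σ w + w + σ w))
    (hy : Tr ((1 + c) * (w * σ y + σ w * y)) = 1 + Tr c + Tr ((1 + c) * (w * σ w))) :
    ∃ x y a : K,
      σ (x + a) * (x + a) + c * (σ x * x) = σ (y + (a + 1)) * (y + (a + 1)) + c * (σ y * y) ∧
      Tr ((c + 1) * (σ x * x + σ y * y)) = 1 := by
  have h2 : (2 : K) = 0 := two_eq_zero_of_algebra_zmod_two
  refine ⟨y + w + 1, y, b + (1 + c) * y, ?_, ?_⟩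
  · simp only [map_add, map_mul, map_one, hc]
    grind
  · have hc1 : σ (1 + c) = 1 + c := by rw [map_add, map_one, hc]
    have key : (c + 1) * (σ (y + w + 1) * (y + w + 1) + σ y * y) =
        (1 + c) * (w * σ y + σ w * y) + (1 + c) * (w * σ w) +
          (1 + c) * ((y + w) + σ (y + w)) + (1 + c) := by
      simp only [map_add, map_one]
      grind
    rw [key, map_add, map_add, map_add, trace_mul_add_map_eq_zero σ hc1, hy, map_add, h1]
    generalize Tr c = s
    generalize Tr ((1 + c) * (w * σ w)) = t
    revert s t
    decide

theorem exists_eigenvector_of_order_three (σ : K ≃ₐ[ZMod 2] K) (hσ : ∀ v, σ (σ (σ v)) = v)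
    (hne : ∃ v, σ v ≠ v) {ζ : K} (hζ : ζ ^ 2 + ζ + 1 = 0) (hσζ : σ ζ = ζ) :
    ∃ η x : K, η ^ 2 + η + 1 = 0 ∧ σ η = η ∧ x ≠ 0 ∧ σ x = η * x := by
  have h2 : (2 : K) = 0 := two_eq_zero_of_algebra_zmod_two
  obtain ⟨v, hv⟩ := hne
  have heig : ∀ η : K, η ^ 2 + η + 1 = 0 → σ η = η →
      σ (v + η ^ 2 * σ v + η * σ (σ v)) = η * (v + η ^ 2 * σ v + η * σ (σ v)) := by
    intro η hη hση
    simp only [map_add, map_mul, map_pow, hση, hσ]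
    linear_combination -(η - 1) * σ v * hη
  have hζ' : (ζ ^ 2) ^ 2 + ζ ^ 2 + 1 = 0 := by
    linear_combination (ζ ^ 2 - ζ + 1) * hζ
  have hσζ' : σ (ζ ^ 2) = ζ ^ 2 := by rw [map_pow, hσζ]
  by_cases h : v + ζ ^ 2 * σ v + ζ * σ (σ v) = 0
  · refine ⟨ζ ^ 2, _, hζ', hσζ', fun h' ↦ hv ?_, heig _ hζ' hσζ'⟩
    refine σ.injective ?_
    linear_combination h + h' - (ζ ^ 2 - ζ + 1) * σ v * hζ - σ (σ v) * hζ + (σ (σ v) - v) * h2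
  · exact ⟨ζ, _, hζ, hσζ, h, heig ζ hζ hσζ⟩

/-- When `σ ^ 3 = 1`, the linear system is governed by one trace condition on the elementary
symmetric functions of the conjugates of `w`. -/
theorem linear_system_solvable_of_order_three (σ : K ≃ₐ[ZMod 2] K) (hσ : ∀ v, σ (σ (σ v)) = v)
    {c w : K} (hc : σ c = c) (hc0 : c ≠ 0) (hw : σ w ≠ w)
    (htr : Tr (c + (1 + c) * (w + w * σ w) +
      (1 + c) ^ 2 / c * (w * σ w * σ (σ w))) = 1) :
    ∃ b y : K,
      w * σ b + σ w * b = c * (y + σ y + 1) + (1 + c) * (w * σ w + w + σ w) ∧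
      Tr ((1 + c) * (w * σ y + σ w * y)) = 1 + Tr c + Tr ((1 + c) * (w * σ w)) := by
  have h2 : (2 : K) = 0 := two_eq_zero_of_algebra_zmod_two
  have hc1 : σ (1 + c) = 1 + c := by rw [map_add, map_one, hc]
  have hw0 : w ≠ 0 := by rintro rfl; simp at hw
  have hu0 : σ w ≠ 0 := by simpa using hw0
  have hv0 : σ (σ w) ≠ 0 := by simpa using hw0
  have hwu : w + σ w ≠ 0 := fun h ↦ hw (by grind)
  have huv : σ w + σ (σ w) ≠ 0 := by rw [← map_add]; exact (map_ne_zero σ).2 hwu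
  have hvw : σ (σ w) + w ≠ 0 := by
    have : σ (σ w + σ (σ w)) ≠ 0 := (map_ne_zero σ).2 huv
    rwa [map_add, hσ] at this
  obtain ⟨M, hM⟩ : ∃ M, M = w + σ w + σ (σ w) + (1 + c) / c * (w * σ w * σ (σ w)) := ⟨_, rfl⟩
  have hσM : σ M = M := by
    rw [hM]
    simp only [map_add, map_mul, map_div₀, map_one, hc, hσ]
    ring
  have hcM : c * M = c * (w + σ w + σ (σ w)) + (1 + c) * (w * σ w * σ (σ w)) := by
    rw [hM]
    field_simp
  obtain ⟨y, hy⟩ : ∃ y, y = M / (σ w + σ (σ w)) := ⟨_, rfl⟩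
  have hyM : (σ w + σ (σ w)) * y = M := by rw [hy]; field_simp
  have hσyM : (σ (σ w) + w) * σ y = M := by
    have := congrArg σ hyM
    rwa [map_mul, map_add, hσ, hσM] at this
  have hσσyM : (w + σ w) * σ (σ y) = M := by
    have := congrArg σ hσyM
    rwa [map_mul, map_add, hσ, hσM] at this
  obtain ⟨R, hR⟩ : ∃ R, R = (c * (y + σ y + 1) + (1 + c) * (w * σ w + w + σ w)) / (w * σ w) :=
    ⟨_, rfl⟩
  have hR0 : w * σ w * R = c * (y + σ y + 1) + (1 + c) * (w * σ w + w + σ w) := by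
    rw [hR]; field_simp
  have hR1 := congrArg σ hR0
  have hR2 := congrArg σ hR1
  simp only [map_add, map_mul, map_one, hc, hσ] at hR1 hR2
  have hRsum : R + σ R + σ (σ R) = 0 := by
    refine (mul_eq_zero.1 (?_ : (w * σ w * σ (σ w)) * (R + σ R + σ (σ R)) = 0)).resolve_left
      (mul_ne_zero (mul_ne_zero hw0 hu0) hv0)
    linear_combination σ (σ w) * hR0 + w * hR1 + σ w * hR2 + c * hyM + c * hσyM + c * hσσyM
      + 3 * hcM + (2 * c * (w + σ w + σ (σ w)) + 3 * (1 + c) * (w * σ w * σ (σ w)) +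
        (1 + c) * (w * σ w + σ w * σ (σ w) + σ (σ w) * w)) * h2
  refine ⟨w * σ R, y, ?_, ?_⟩
  · rw [map_mul, ← hR0]
    linear_combination w * σ w * hRsum - w * σ w * R * h2
  · have hsplit : Tr ((1 + c) * (w * σ y + σ w * y)) = Tr ((1 + c) * M) := by
      have h : Tr ((1 + c) * (w * σ y)) = Tr ((1 + c) * (σ (σ w) * y)) := by
        rw [← Algebra.trace_eq_of_algEquiv σ ((1 + c) * (σ (σ w) * y))]
        simp only [map_mul, hc1, hσ]
      rw [mul_add, map_add, h, ← map_add, ← hyM]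
      congr 1
      ring
    have hM' : (1 + c) * M = (1 + c) * w + (1 + c) * (σ w + σ (σ w)) +
        (1 + c) ^ 2 / c * (w * σ w * σ (σ w)) := by
      rw [hM]; ring
    rw [hsplit, hM', map_add, map_add, trace_mul_add_map_eq_zero σ hc1]
    rw [mul_add, map_add, map_add, map_add] at htr
    generalize Tr c = s1 at *
    generalize Tr ((1 + c) * w) = s2 at *
    generalize Tr ((1 + c) * (w * σ w)) = s3 at *
    generalize Tr ((1 + c) ^ 2 / c * (w * σ w * σ (σ w))) = s4 at *
    clear * - htr
    revert s1 s2 s3 s4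
    decide

variable [Finite K]

theorem eq_zero_of_forall_trace_mul_eq_zero {z : K} (h : ∀ y, Tr (z * y) = 0) : z = 0 :=
  (traceForm_nondegenerate (ZMod 2) K).1 z h

theorem exists_trace_eq_one : ∃ t : K, Tr t = 1 := by
  by_contra! h
  refine one_ne_zero (α := K) (eq_zero_of_forall_trace_mul_eq_zero fun y ↦ ?_)
  have := h (1 * y)
  generalize Tr (1 * y) = s at *
  revert s
  decide

theorem exists_trace_representation (f : K →ₗ[ZMod 2] ZMod 2) :
    ∃ z, ∀ v, f v = Tr (z * v) :=
  ⟨((Algebra.traceForm (ZMod 2) K).toDual (traceForm_nondegenerate (ZMod 2) K)).symm f,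
    fun v ↦ (LinearMap.BilinForm.apply_toDual_symm_apply (B := Algebra.traceForm (ZMod 2) K)
      f v).symm⟩

/-- If `w` is not fixed by `σ ^ 3` the linear system has a solution for every right-hand side. -/
theorem linear_system_solvable (σ : K ≃ₐ[ZMod 2] K) {c w : K} (hc : σ c = c)
    (hc0 : c ≠ 0) (hc1 : c ≠ 1) (hw2 : σ (σ w) ≠ w) (hw3 : σ (σ (σ w)) ≠ w)
    (r : K) (s : ZMod 2) :
    ∃ b y : K, w * σ b + σ w * b + c * (y + σ y) = r ∧
      Tr ((1 + c) * (w * σ y + σ w * y)) = s := by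
  have h2 : (2 : K) = 0 := two_eq_zero_of_algebra_zmod_two
  have hw0 : w ≠ 0 := by rintro rfl; simp at hw2
  have hσσw0 : σ (σ w) ≠ 0 := by simpa using hw0
  let S : K →ₗ[ZMod 2] K := σ.toLinearMap
  let m : K → K →ₗ[ZMod 2] K := LinearMap.mulLeft (ZMod 2)
  let L : K × K →ₗ[ZMod 2] K × ZMod 2 :=
    ((m w ∘ₗ S + m (σ w)).coprod (m c ∘ₗ (LinearMap.id + S))).prod
      ((Tr ∘ₗ m (1 + c) ∘ₗ (m w ∘ₗ S + m (σ w))) ∘ₗ LinearMap.snd (ZMod 2) K K)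
  have hL : ∀ b y, L (b, y) = (w * σ b + σ w * b + c * (y + σ y),
      Tr ((1 + c) * (w * σ y + σ w * y))) := fun b y ↦ rfl
  suffices hrange : (r, s) ∈ LinearMap.range L by
    obtain ⟨⟨b, y⟩, h⟩ := hrange
    rw [hL, Prod.mk.injEq] at h
    exact ⟨b, y, h⟩
  by_contra hrs
  obtain ⟨f, hf, hker⟩ := Submodule.exists_le_ker_of_notMem hrs
  obtain ⟨z, hz⟩ := exists_trace_representation (f ∘ₗ LinearMap.inl (ZMod 2) K (ZMod 2))
  have hfz : ∀ v t, f (v, t) = Tr (z * v) + t * f (0, 1) := by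
    intro v t
    rw [← hz v, ← smul_eq_mul, ← map_smul, LinearMap.comp_apply, ← map_add]
    simp
  have hvanish : ∀ b y, Tr (z * (w * σ b + σ w * b + c * (y + σ y))) +
      Tr ((1 + c) * (w * σ y + σ w * y)) * f (0, 1) = 0 := by
    intro b y
    rw [← hfz, ← hL]
    exact hker ⟨(b, y), rfl⟩
  have hb : z * w = σ z * σ (σ w) := by
    suffices h : z * w + σ z * σ (σ w) = 0 by grind
    refine eq_zero_of_forall_trace_mul_eq_zero fun t ↦ ?_
    obtain ⟨b, rfl⟩ := σ.surjective t
    have h := hvanish b 0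
    simp only [map_zero, mul_zero, add_zero, zero_mul] at h
    rw [← h, mul_add, add_mul, map_add, map_add, ← Algebra.trace_eq_of_algEquiv σ (z * (σ w * b))]
    simp only [map_mul, mul_assoc]
  have hσz : ∀ e : K, (∀ y, Tr (z * (c * (y + σ y)) + e * (1 + c) * (w * σ y + σ w * y)) = 0) →
      σ e = e → c * (z + σ z) + e * (1 + c) * (w + σ (σ w)) = 0 := by
    intro e he hσe
    refine eq_zero_of_forall_trace_mul_eq_zero fun t ↦ ?_
    obtain ⟨y, rfl⟩ := σ.surjective t
    rw [← he y]
    have e1 : Tr (z * (c * (y + σ y)) + e * (1 + c) * (w * σ y + σ w * y)) =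
        Tr (σ (z * c * y + e * (1 + c) * σ w * y)) +
          Tr (z * c * σ y + e * (1 + c) * w * σ y) := by
      rw [Algebra.trace_eq_of_algEquiv, ← map_add]
      congr 1
      ring
    rw [e1, ← map_add]
    congr 1
    simp only [map_add, map_mul, map_one, hc, hσe]
    ring
  have hε : f (0, 1) = 0 ∨ f (0, 1) = 1 := by
    generalize f (0, 1) = s
    revert s
    decide
  rcases hε with hε | hε
  · have h := hσz 0 (fun y ↦ by simpa [hε] using hvanish 0 y) (map_zero σ)
    have hzz : σ z = z := by
      have : z + σ z = 0 := by simpa [hc0] using h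
      grind
    have hz0 : z = 0 := by
      by_contra hz0
      rw [hzz] at hb
      exact hw2 (mul_left_cancel₀ hz0 hb).symm
    exact hf (by rw [hfz, hε, hz0, zero_mul, map_zero, mul_zero, add_zero])
  · have h := hσz 1 (fun y ↦ by simpa [hε] using hvanish 0 y) (map_one σ)
    have hcz : c * z = (1 + c) * σ (σ w) := by
      have hne : w + σ (σ w) ≠ 0 := fun h0 ↦ hw2 (by grind)
      refine mul_right_cancel₀ hne ?_
      linear_combination σ (σ w) * h - c * hb +
        (c * z * w - (1 + c) * σ (σ w) * (w + σ (σ w)) - c * σ (σ w) * σ z) * h2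
    have hσcz := congrArg σ hcz
    simp only [map_mul, map_add, map_one, hc] at hσcz
    have hne : (1 + c) ≠ 0 := fun h0 ↦ hc1 (by grind)
    refine hw3 (mul_left_cancel₀ (mul_ne_zero hne hσσw0) ?_)
    linear_combination w * hcz - c * hb - σ (σ w) * hσcz

/-- The trace condition of `linear_system_solvable_of_order_three` can be met: its second
difference at an eigenvector `x` of `σ`, in the directions `x ^ 2` and `l` with `σ l = l`, is
`Tr ((1 + c) ^ 2 / c * (l * x ^ 3))`. -/
theorem exists_trace_condition_of_order_three (σ : K ≃ₐ[ZMod 2] K)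
    (hσ : ∀ v, σ (σ (σ v)) = v) {c η x : K} (hc : σ c = c) (hc0 : c ≠ 0) (hc1 : c ≠ 1)
    (hη : η ^ 2 + η + 1 = 0) (hση : σ η = η) (hx0 : x ≠ 0) (hx : σ x = η * x) :
    ∃ w, σ w ≠ w ∧ Tr (c + (1 + c) * (w + w * σ w) +
      (1 + c) ^ 2 / c * (w * σ w * σ (σ w))) = 1 := by
  have h2 : (2 : K) = 0 := two_eq_zero_of_algebra_zmod_two
  have hη1 : η ≠ 1 := by
    rintro rfl
    exact one_ne_zero (α := K) (by linear_combination hη - h2)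
  have hη0 : η ≠ 0 := by rintro rfl; simp at hη
  have hη3 : η ^ 3 = 1 := by linear_combination (η - 1) * hη
  have hσx3 : σ (x ^ 3) = x ^ 3 := by rw [map_pow, hx, mul_pow, hη3, one_mul]
  have h1c : 1 + c ≠ 0 := fun h ↦ hc1 (by grind)
  obtain ⟨k, hk⟩ : ∃ k, k = (1 + c) ^ 2 / c := ⟨_, rfl⟩
  have hk0 : k ≠ 0 := by rw [hk]; exact div_ne_zero (pow_ne_zero 2 h1c) hc0
  have hσk : σ k = k := by
    rw [hk]
    simp only [map_div₀, map_pow, map_add, map_one, hc]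
  obtain ⟨t, ht⟩ := exists_trace_eq_one (K := K)
  obtain ⟨l, hl⟩ : ∃ l, l = (t + σ t + σ (σ t)) / (k * x ^ 3) := ⟨_, rfl⟩
  have hσl : σ l = l := by
    rw [hl, map_div₀, map_mul, hσx3, hσk, map_add, map_add, hσ]
    ring
  have hkl : k * (l * x ^ 3) = t + σ t + σ (σ t) := by
    rw [hl]; field_simp
  have htr : Tr (k * (l * x ^ 3)) = 1 := by
    rw [hkl, map_add, map_add]
    simp only [Algebra.trace_eq_of_algEquiv, ht]
    decide
  have hA : σ x ≠ x := by
    rw [hx]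
    exact fun h ↦ hη1 (mul_right_cancel₀ hx0 (by rw [h, one_mul]))
  have hB : σ (x + x ^ 2) ≠ x + x ^ 2 := by
    rw [map_add, map_pow, hx]
    intro h
    have hxη : x = η := by
      have : η * x * (x + η) = 0 := by grind
      have := (mul_eq_zero.1 this).resolve_left (mul_ne_zero hη0 hx0)
      grind
    exact hA (by rw [hxη, hση])
  have hshift : ∀ w, σ w ≠ w → σ (l + w) ≠ l + w := by
    intro w hw h
    rw [map_add, hσl] at h
    exact hw (add_left_cancel h)
  by_contra! hall
  rw [← hk] at hall
  have hzero : ∀ w, σ w ≠ w → Tr (c + (1 + c) * (w + w * σ w) + k * (w * σ w * σ (σ w))) = 0 := by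
    intro w hw
    have := hall w hw
    generalize Tr (c + (1 + c) * (w + w * σ w) + k * (w * σ w * σ (σ w))) = s at *
    clear * - this
    revert s
    decide
  have hsum : k * (l * x ^ 3) =
      (c + (1 + c) * (x + x * σ x) + k * (x * σ x * σ (σ x))) +
      (c + (1 + c) * ((x + x ^ 2) + (x + x ^ 2) * σ (x + x ^ 2)) +
        k * ((x + x ^ 2) * σ (x + x ^ 2) * σ (σ (x + x ^ 2)))) +
      (c + (1 + c) * ((l + x) + (l + x) * σ (l + x)) +
        k * ((l + x) * σ (l + x) * σ (σ (l + x)))) +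
      (c + (1 + c) * ((l + (x + x ^ 2)) + (l + (x + x ^ 2)) * σ (l + (x + x ^ 2))) +
        k * ((l + (x + x ^ 2)) * σ (l + (x + x ^ 2)) * σ (σ (l + (x + x ^ 2))))) +
      (1 + c) * l * (x ^ 2 + σ (x ^ 2)) := by
    simp only [map_add, map_pow, map_mul, hx, hσl, hση]
    clear * - h2 hη
    grind
  have hσ1cl : σ ((1 + c) * l) = (1 + c) * l := by rw [map_mul, map_add, map_one, hc, hσl]
  rw [hsum, map_add, map_add, map_add, map_add, hzero _ hA, hzero _ hB, hzero _ (hshift _ hA),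
    hzero _ (hshift _ hB), trace_mul_add_map_eq_zero σ hσ1cl] at htr
  exact absurd htr (by decide)

theorem exists_collision_of_trace_eq_one (σ : K ≃ₐ[ZMod 2] K) (h1 : Tr (1 : K) = 0)
    (hσ2 : ∀ w, σ (σ w) = w → σ w = w) (hne : ∃ v, σ v ≠ v)
    {ζ : K} (hζ : ζ ^ 2 + ζ + 1 = 0) (hσζ : σ ζ = ζ)
    {c : K} (hc : σ c = c) (hc0 : c ≠ 0) (hc1 : c ≠ 1) :
    ∃ x y a : K,
      σ (x + a) * (x + a) + c * (σ x * x) = σ (y + (a + 1)) * (y + (a + 1)) + c * (σ y * y) ∧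
      Tr ((c + 1) * (σ x * x + σ y * y)) = 1 := by
  have h2 : (2 : K) = 0 := two_eq_zero_of_algebra_zmod_two
  by_cases hσ : ∀ v, σ (σ (σ v)) = v
  · obtain ⟨η, x, hη, hση, hx0, hx⟩ := exists_eigenvector_of_order_three σ hσ hne hζ hσζ
    obtain ⟨w, hw, htr⟩ :=
      exists_trace_condition_of_order_three σ hσ hc hc0 hc1 hη hση hx0 hx
    obtain ⟨b, y, hb, hy⟩ := linear_system_solvable_of_order_three σ hσ hc hc0 hw htr
    exact exists_collision_of_linear_system σ h1 hc hb hy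
  · push Not at hσ
    obtain ⟨w, hw⟩ := hσ
    have hw2 : σ (σ w) ≠ w := fun h ↦ hw (by rw [h, hσ2 w h])
    obtain ⟨b, y, hb, hy⟩ := linear_system_solvable σ hc hc0 hc1 hw2 hw
      (c + (1 + c) * (w * σ w + w + σ w)) (1 + Tr c + Tr ((1 + c) * (w * σ w)))
    refine exists_collision_of_linear_system σ h1 hc (b := b) (y := y) ?_ hy
    linear_combination hb - c * (y + σ y) * h2

end TraceForm

theorem aTr_eq_algebraMap_trace {n : ℕ} (hn : n ≠ 0) (x : GaloisField 2 n) :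
    aTr n x = algebraMap (ZMod 2) _ (Algebra.trace (ZMod 2) (GaloisField 2 n) x) := by
  rw [FiniteField.algebraMap_trace_eq_sum_pow, GaloisField.finrank 2 hn, Nat.card_zmod, aTr]

theorem pow_two_pow_eq_self_of_dvd {M : Type*} [Monoid M] {x : M} {d e : ℕ}
    (hx : x ^ 2 ^ d = x) (hde : d ∣ e) : x ^ 2 ^ e = x := by
  have h : ∀ k, x ^ 2 ^ k = (fun z : M ↦ z ^ 2)^[k] x := fun k ↦ by rw [pow_iterate]
  rw [h] at hx ⊢
  exact Function.IsPeriodicPt.trans_dvd hx hde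

theorem pow_two_pow_gcd_eq_self_s11 {M : Type*} [Monoid M] {x : M} {d e : ℕ}
    (hd : x ^ 2 ^ d = x) (he : x ^ 2 ^ e = x) : x ^ 2 ^ Nat.gcd d e = x := by
  have h : ∀ k, x ^ 2 ^ k = (fun z : M ↦ z ^ 2)^[k] x := fun k ↦ by rw [pow_iterate]
  rw [h] at hd he ⊢
  exact Function.IsPeriodicPt.gcd hd he

theorem exists_pow_two_pow_ne_self {K : Type*} [Field K] [Finite K] {n d : ℕ}
    (hcard : Nat.card K = 2 ^ n) (hd0 : d ≠ 0) (hdn : d < n) : ∃ v : K, v ^ 2 ^ d ≠ v := by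
  by_contra! h
  obtain ⟨g, hg⟩ := IsCyclic.exists_ofOrder_eq_natCard (α := Kˣ)
  have hg1 : g ^ (2 ^ d - 1) = 1 := by
    have hgd : g ^ 2 ^ d = g := Units.ext (by simpa using h g)
    refine mul_right_cancel (b := g) ?_
    rw [← pow_succ, Nat.sub_add_cancel Nat.one_le_two_pow, hgd, one_mul]
  have hle := Nat.le_of_dvd (Nat.sub_pos_of_lt (Nat.one_lt_two_pow hd0))
    (orderOf_dvd_of_pow_eq_one hg1)
  rw [hg, Nat.card_units, hcard] at hle
  have := Nat.pow_lt_pow_right (a := 2) one_lt_two hdn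
  have := Nat.one_le_two_pow (n := d)
  omega

theorem exists_primitive_cube_root {K : Type*} [Field K] [Finite K] {n : ℕ}
    (hcard : Nat.card K = 2 ^ n) (hn : Even n) : ∃ ζ : K, ζ ^ 2 + ζ + 1 = 0 := by
  have hdvd : 3 ∣ Nat.card Kˣ := by
    obtain ⟨j, rfl⟩ := hn
    rw [Nat.card_units, hcard, ← two_mul, pow_mul]
    simpa using Nat.sub_one_dvd_pow_sub_one 4 j
  have : Fact (Nat.Prime 3) := ⟨Nat.prime_three⟩
  obtain ⟨u, hu⟩ := exists_prime_orderOf_dvd_card' 3 hdvd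
  have hu3 : (u : K) ^ 3 = 1 := by
    rw [← Units.val_pow_eq_pow_val, ← hu, pow_orderOf_eq_one, Units.val_one]
  have hu1 : (u : K) - 1 ≠ 0 := by
    intro h
    have : u = 1 := Units.ext (by simpa using sub_eq_zero.1 h)
    simp [this] at hu
  exact ⟨u, (mul_eq_zero.1 (by linear_combination hu3 :
    ((u : K) - 1) * ((u : K) ^ 2 + u + 1) = 0)).resolve_left hu1⟩

/-- with `c ∈ F_{2^d} \ F_2`, `d = gcd(2i,n) = gcd(i,n) < n` and
`n = dm` even, setting `f_a(x) = (x+a)^{2^i+1} + c·x^{2^i+1}`, there exist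
`x, y, a` with `f_a(x) = f_{a+1}(y)` and `tr((c+1)(x^{2^i+1} + y^{2^i+1})) = 1`. -/
theorem stmt11 (n i d m : ℕ) (hnm : n = d * m) (hne : Even n)
    (hd2 : d = Nat.gcd (2 * i) n) (hd1 : d = Nat.gcd i n) (hdn : d < n)
    (c : GaloisField 2 n) (hc : c ^ 2 ^ d = c) (hc0 : c ≠ 0) (hc1 : c ≠ 1) :
    ∃ x y a : GaloisField 2 n,
      (x + a) ^ (2 ^ i + 1) + c * x ^ (2 ^ i + 1) =
        (y + (a + 1)) ^ (2 ^ i + 1) + c * y ^ (2 ^ i + 1) ∧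
      aTr n ((c + 1) * (x ^ (2 ^ i + 1) + y ^ (2 ^ i + 1))) = 1 := by
  have hn0 : n ≠ 0 := by omega
  have hcard : Nat.card (GaloisField 2 n) = 2 ^ n := GaloisField.card 2 n hn0
  have hdi : d ∣ i := hd1 ▸ Nat.gcd_dvd_left i n
  have hd0 : d ≠ 0 := by rintro rfl; simp at hnm; omega
  have hfix : ∀ v : GaloisField 2 n, v ^ 2 ^ n = v := fun v ↦ by
    have := Fintype.ofFinite (GaloisField 2 n)
    rw [← hcard, Nat.card_eq_fintype_card, FiniteField.pow_card]
  let σ := FiniteField.frobeniusAlgEquivOfAlgebraic (ZMod 2) (GaloisField 2 n) ^ i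
  have hσ : ∀ v, σ v = v ^ 2 ^ i := fun v ↦ by
    rw [AlgEquiv.coe_pow, FiniteField.coe_frobeniusAlgEquivOfAlgebraic_iterate, ZMod.card]
  have hσd : ∀ v, v ^ 2 ^ d = v → σ v = v := fun v hv ↦ by
    rw [hσ]; exact pow_two_pow_eq_self_of_dvd hv hdi
  have hσ2 : ∀ v, σ (σ v) = v → σ v = v := fun v hv ↦ by
    refine hσd v ?_
    rw [hσ, hσ, ← pow_mul, ← pow_add, ← two_mul] at hv
    rw [hd2]
    exact pow_two_pow_gcd_eq_self_s11 hv (hfix v)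
  have hnontriv : ∃ v, σ v ≠ v := by
    obtain ⟨v, hv⟩ := exists_pow_two_pow_ne_self hcard hd0 hdn
    refine ⟨v, fun h ↦ hv ?_⟩
    rw [hσ] at h
    rw [hd1]
    exact pow_two_pow_gcd_eq_self_s11 h (hfix v)
  obtain ⟨ζ, hζ⟩ := exists_primitive_cube_root hcard hne
  have hi : Even i := by
    have h2d : 2 ∣ d := hd2 ▸ Nat.dvd_gcd (dvd_mul_right 2 i) hne.two_dvd
    exact even_iff_two_dvd.2 (h2d.trans hdi)
  have hσζ : σ ζ = ζ := by
    rw [hσ]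
    refine pow_two_pow_eq_self_of_dvd (d := 2) ?_ hi.two_dvd
    linear_combination (ζ ^ 2 - ζ) * hζ
  have h1 : Algebra.trace (ZMod 2) (GaloisField 2 n) 1 = 0 := by
    rw [← map_one (algebraMap (ZMod 2) (GaloisField 2 n)), Algebra.trace_algebraMap,
      GaloisField.finrank 2 hn0, nsmul_one]
    exact (ZMod.natCast_eq_zero_iff_even).2 hne
  obtain ⟨x, y, a, hxy, htr⟩ :=
    exists_collision_of_trace_eq_one σ h1 hσ2 hnontriv hζ hσζ (hσd c hc) hc0 hc1
  simp only [hσ, ← pow_succ] at hxy htr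
  exact ⟨x, y, a, hxy, by rw [aTr_eq_algebraMap_trace hn0, htr, map_one]⟩
end

section
/- Let c ∈ F_{2^d} \ F_2 with d = gcd(2i, n) = gcd(i, n) < n, let n be even, and let G(x) = (x + tr(x^{2^i+1}))^{2^i+1} on F_{2^n}. Then: (i) for every a ∈ F_{2^d} and every b ∈ F_{2^n}, the equation G(x+a) + c·G(x) = b has exactly one solution x ∈ F_{2^n}; (ii) there exist a ∈ F_{2^n} \ F_{2^d} and b ∈ F_{2^n} such that the equation G(x+a) + c·G(x) = b has at least two solutions x ∈ F_{2^n}. -/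
/-- The function `G(x) = (x + tr(x^{2^i+1}))^{2^i+1}` on `F_{2^n}`. -/
noncomputable def Gfun (n i : ℕ) (x : GaloisField 2 n) : GaloisField 2 n :=
  (x + aTr n (x ^ (2 ^ i + 1))) ^ (2 ^ i + 1)

section Gold

variable {K : Type*} [Field K] [Algebra (ZMod 2) K]

local notation "tr" => Algebra.trace (ZMod 2) K

/-- The map `x ↦ x + tr(σ(x) x)`; for `σ` a power of Frobenius, `x ↦ x + tr(x^{2^i+1})`. -/
noncomputable def traceShift (σ : K ≃ₐ[ZMod 2] K) (x : K) : K :=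
  x + algebraMap (ZMod 2) K (tr (σ x * x))

variable {σ : K ≃ₐ[ZMod 2] K}

lemma trace_fixed_mul_apply {k : K} (hk : σ k = k) (x : K) : tr (k * σ x) = tr (k * x) := by
  rw [← Algebra.trace_eq_of_algEquiv σ (k * x), map_mul σ, hk]

lemma eq_zero_of_trace_mul_apply_eq_zero [Finite K] {p : K} (h : ∀ x, tr (p * σ x) = 0) :
    p = 0 := by
  refine (traceForm_nondegenerate (ZMod 2) K).1 p fun y => ?_
  simpa using h (σ.symm y)

lemma exists_trace_mul_eq_s12 [Finite K] (φ : K →ₗ[ZMod 2] ZMod 2) : ∃ p, ∀ x, φ x = tr (p * x) :=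
  ⟨_, fun x => (LinearMap.BilinForm.apply_toDual_symm_apply
    (hB := traceForm_nondegenerate (ZMod 2) K) (f := φ) x).symm⟩

/-- If `σ` and `σ²` have the same fixed points, then `x ↦ σ(x) x` is injective. -/
lemma mul_apply_injective [CharP K 2] (hfix : ∀ x, σ (σ x) = x → σ x = x) :
    Function.Injective fun x => σ x * x := by
  intro x y h
  simp only at h
  by_cases hy : y = 0
  · subst hy
    simpa using h
  have hσy : σ y ≠ 0 := by simpa using hy
  have hx : x ≠ 0 := by
    rintro rfl
    simp_all
  have hr : σ (x / y) = (x / y)⁻¹ := by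
    rw [map_div₀]
    field_simp
    linear_combination h
  have hr2 := hfix (x / y) (by rw [hr, map_inv₀, hr, inv_inv])
  have : (x / y) ^ 2 = 1 := by
    rw [sq]
    nth_rewrite 1 [← hr2]
    rw [hr]
    field_simp
  have h1 : x / y = 1 := by
    have : (x / y - 1) ^ 2 = 0 := by rw [sub_pow_char]; simp [this]
    exact sub_eq_zero.1 (pow_eq_zero_iff (two_ne_zero) |>.1 this)
  rwa [div_eq_one_iff_eq hy] at h1

lemma trace_apply_add_mul_add (x a : K) :
    tr (σ (x + a) * (x + a)) =
      tr (σ x * x) + tr (σ a * a) + tr (a * σ x + σ a * x) := by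
  rw [← map_add, ← map_add, map_add σ]
  congr 1
  ring

lemma trace_polar_fixed [CharP K 2] {k : K} (hk : σ k = k) (x : K) :
    tr (k * σ x + σ k * x) = 0 := by
  rw [map_add, hk, trace_fixed_mul_apply hk, CharTwo.add_self_eq_zero]

lemma trace_polar_fixed_right [CharP K 2] {k : K} (hk : σ k = k) (x : K) :
    tr (x * σ k + σ x * k) = 0 := by
  rw [add_comm, mul_comm (σ x), mul_comm x, trace_polar_fixed hk]

lemma apply_algebraMap_mul_self (t : ZMod 2) :
    σ (algebraMap (ZMod 2) K t) * algebraMap (ZMod 2) K t = algebraMap (ZMod 2) K t := by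
  rw [AlgEquiv.commutes, ← map_mul]
  congr 1
  revert t
  decide

lemma trace_algebraMap_eq_zero (h1 : tr 1 = 0) (t : ZMod 2) :
    tr (algebraMap (ZMod 2) K t) = 0 := by
  rw [Algebra.algebraMap_eq_smul_one, map_smul, h1, smul_zero]

/-- `traceShift` is additive up to the trace of the polar form of `x ↦ σ(x) x`. -/
lemma traceShift_add (x a : K) :
    traceShift σ (x + a) =
      traceShift σ x + traceShift σ a + algebraMap (ZMod 2) K (tr (a * σ x + σ a * x)) := by
  rw [traceShift, trace_apply_add_mul_add, map_add (algebraMap (ZMod 2) K),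
    map_add (algebraMap (ZMod 2) K), traceShift, traceShift]
  ring

lemma trace_polar_traceShift [CharP K 2] (a y : K) :
    tr (traceShift σ a * σ (traceShift σ y) + σ (traceShift σ a) * traceShift σ y) =
      tr (a * σ y + σ a * y) := by
  have expand : ∀ s t : K, (a + s) * σ (y + t) + σ (a + s) * (y + t) =
      (a * σ y + σ a * y) + (s * σ (y + t) + σ s * (y + t)) + (a * σ t + σ a * t) := by
    intro s t
    simp only [map_add]
    ring
  rw [traceShift, traceShift, expand, map_add, map_add (tr),
    trace_polar_fixed (AlgEquiv.commutes σ _), trace_polar_fixed_right (AlgEquiv.commutes σ _),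
    add_zero, add_zero]

lemma traceShift_traceShift [CharP K 2] (h1 : tr 1 = 0) (x : K) :
    traceShift σ (traceShift σ x) = x := by
  conv_lhs => rw [traceShift, traceShift]
  rw [trace_apply_add_mul_add, apply_algebraMap_mul_self, trace_algebraMap_eq_zero h1,
    trace_polar_fixed (AlgEquiv.commutes σ _), add_zero, add_zero, add_assoc,
    CharTwo.add_self_eq_zero, add_zero]

/-- Completing the "square" in `x ↦ σ(x + a)(x + a) + c σ(x) x`. -/
lemma apply_mul_add_const_mul [CharP K 2] {c : K} (hσc : σ c = c) (hc1 : c ≠ 1) (y a : K) :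
    σ (y + a) * (y + a) + c * (σ y * y) =
      (1 + c) * (σ (y + a / (1 + c)) * (y + a / (1 + c))) + c / (1 + c) * (σ a * a) := by
  have hc : 1 + c ≠ 0 := fun h => hc1 (by grind)
  simp only [map_add, map_div₀, map_one, hσc]
  field_simp
  grind

lemma bijective_of_fixed [Finite K] [CharP K 2] (hfix : ∀ x, σ (σ x) = x → σ x = x)
    (h1 : tr 1 = 0) {c : K} (hσc : σ c = c) (hc1 : c ≠ 1) {a : K} (ha : σ a = a) :
    Function.Bijective fun x => σ (traceShift σ (x + a)) * traceShift σ (x + a) +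
      c * (σ (traceShift σ x) * traceShift σ x) := by
  have hc : 1 + c ≠ 0 := fun h => hc1 (by grind)
  refine Finite.injective_iff_bijective.1 fun x y h => ?_
  simp only [traceShift_add, trace_polar_fixed ha, map_zero, add_zero] at h
  rw [apply_mul_add_const_mul hσc hc1, apply_mul_add_const_mul hσc hc1] at h
  have := mul_apply_injective hfix (mul_left_cancel₀ hc (add_right_cancel h))
  rw [← traceShift_traceShift h1 x, ← traceShift_traceShift h1 y, add_right_cancel this]

/-- A non-fixed element `w` avoiding the obstruction to solving the linear system of
`exists_linear_system_solution`. -/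
lemma exists_unobstructed [Finite K] [CharP K 2] (hfix : ∀ x, σ (σ x) = x → σ x = x)
    (h1 : tr 1 = 0) {c : K} (hσc : σ c = c) (hc0 : c ≠ 0) (hc1 : c ≠ 1)
    {κ : K} (hκ : σ κ = κ) (hκ0 : κ ≠ 0) (hne : ∃ w, σ w ≠ w) :
    ∃ w, σ w ≠ w ∧ ¬(σ (w * σ w * σ (σ w)) = w * σ w * σ (σ w) ∧
      tr (w * σ w * σ (σ w) / κ + w) = 0) := by
  by_contra! H
  have hκi : σ κ⁻¹ = κ⁻¹ := by rw [map_inv₀, hκ]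
  have order_three : ∀ y, σ y ≠ y → σ (σ (σ y)) = y := by
    intro y hy
    have hN := (H y hy).1
    have hy0 : y ≠ 0 := by
      rintro rfl
      simp at hy
    have h1 : σ y ≠ 0 := by simpa using hy0
    have h2 : σ (σ y) ≠ 0 := by simpa using h1
    simp only [map_mul] at hN
    refine mul_left_cancel₀ (mul_ne_zero h1 h2) ?_
    linear_combination hN
  have quad : ∀ y, σ y ≠ y → tr (κ⁻¹ * (y * σ y)) + tr (κ⁻¹ * y) + tr κ⁻¹ = 0 := by
    intro y hy
    have hy1 : σ (y + 1) ≠ y + 1 := by simpa using hy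
    have e1 := (H y hy).2
    have e2 := (H (y + 1) hy1).2
    have e3 : tr (κ⁻¹ * (y * σ (σ y))) = tr (κ⁻¹ * (y * σ y)) := by
      rw [← trace_fixed_mul_apply hκi (y * σ (σ y)), map_mul σ, order_three y hy, mul_comm y]
    have e4 : tr (κ⁻¹ * (σ y * σ (σ y))) = tr (κ⁻¹ * (y * σ y)) := by
      rw [← map_mul, trace_fixed_mul_apply hκi]
    have e5 := trace_fixed_mul_apply hκi y
    have e6 := trace_fixed_mul_apply hκi (σ y)
    have : (y + 1) * σ (y + 1) * σ (σ (y + 1)) / κ + (y + 1) =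
        (y * σ y * σ (σ y) / κ + y) + κ⁻¹ * (y * σ y) + κ⁻¹ * (y * σ (σ y))
        + κ⁻¹ * (σ y * σ (σ y)) + κ⁻¹ * y + κ⁻¹ * σ y + κ⁻¹ * σ (σ y) + κ⁻¹ + 1 := by
      simp only [map_add, map_one]
      ring
    rw [this] at e2
    simp only [map_add (tr)] at e2
    simp only [map_add (tr)] at e1
    grind
  obtain ⟨y, hy⟩ := hne
  have hκtr : tr κ⁻¹ = 0 := by
    have scale : ∀ m, σ m = m → m ≠ 0 → σ (m * y) ≠ m * y := by
      intro m hm hm0 h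
      rw [map_mul, hm] at h
      exact hy (mul_left_cancel₀ hm0 h)
    have hc1' : c + 1 ≠ 0 := fun h => hc1 (by grind)
    have q1 := quad y hy
    have q2 := quad _ (scale c hσc hc0)
    have q3 := quad _ (scale (c + 1) (by simp [hσc]) hc1')
    have s1 : κ⁻¹ * ((c + 1) * y) = κ⁻¹ * (c * y) + κ⁻¹ * y := by ring
    have s2 : κ⁻¹ * ((c + 1) * y * σ ((c + 1) * y)) =
        κ⁻¹ * (c * y * σ (c * y)) + κ⁻¹ * (y * σ y) := by
      simp only [map_mul, map_add, hσc, map_one]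
      linear_combination κ⁻¹ * c * y * σ y * CharTwo.two_eq_zero (R := K)
    rw [s1, s2, map_add, map_add] at q3
    grind
  have polar : ∀ z, tr (κ⁻¹ * (y * σ z)) + tr (κ⁻¹ * (σ y * z)) = 0 := by
    have fixed : ∀ z, σ z = z → tr (κ⁻¹ * (y * σ z)) + tr (κ⁻¹ * (σ y * z)) = 0 := by
      intro z hz
      have hkz : σ (κ⁻¹ * z) = κ⁻¹ * z := by rw [map_mul, hκi, hz]
      rw [hz, mul_comm y, mul_comm (σ y), ← mul_assoc, ← mul_assoc,
        trace_fixed_mul_apply hkz, CharTwo.add_self_eq_zero]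
    intro z
    by_cases hz : σ z = z
    · exact fixed z hz
    by_cases hyz : σ (y + z) = y + z
    · have := fixed _ hyz
      simp only [map_add, mul_add] at this
      rw [mul_comm (σ y) y] at this
      grind
    · have q1 := quad y hy
      have q2 := quad z hz
      have q3 := quad _ hyz
      have : κ⁻¹ * ((y + z) * σ (y + z)) =
          κ⁻¹ * (y * σ y) + κ⁻¹ * (z * σ z) + κ⁻¹ * (y * σ z) + κ⁻¹ * (σ y * z) := by
        rw [map_add]
        ring
      rw [this, mul_add] at q3
      simp only [map_add (tr)] at q3
      grind
  have hzero : κ⁻¹ * (y + σ (σ y)) = 0 := by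
    refine eq_zero_of_trace_mul_apply_eq_zero (σ := σ) fun z => ?_
    have := polar z
    rw [← trace_fixed_mul_apply hκi (σ y * z), map_mul σ, ← map_add] at this
    rw [← this]
    congr 1
    ring
  have := (mul_eq_zero.1 hzero).resolve_left (inv_ne_zero hκ0)
  exact hy (hfix y (by grind))

lemma exists_linear_system_solution [Finite K] [CharP K 2]
    (hfix : ∀ x, σ (σ x) = x → σ x = x)
    {κ : K} (hκ : σ κ = κ) (hκ0 : κ ≠ 0) {w : K} (hw : σ w ≠ w)
    (hobs : ¬(σ (w * σ w * σ (σ w)) = w * σ w * σ (σ w) ∧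
      tr (w * σ w * σ (σ w) / κ + w) = 0)) :
    ∃ a t, κ * (σ a + a) + σ w * w * (σ t + t) = σ w * w + κ ∧
      tr (a * σ w + σ a * w) = 1 := by
  have hw0 : w ≠ 0 := by
    rintro rfl
    simp at hw
  have hσw : σ w ≠ 0 := by simpa using hw0
  have hσσw : σ (σ w) ≠ 0 := by simpa using hσw
  let s : K →ₗ[ZMod 2] K := σ.toLinearMap
  let Φ : K × K →ₗ[ZMod 2] K × ZMod 2 :=
    LinearMap.prod
      (LinearMap.coprod (LinearMap.mulLeft (ZMod 2) κ ∘ₗ (s + LinearMap.id))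
        (LinearMap.mulLeft (ZMod 2) (σ w * w) ∘ₗ (s + LinearMap.id)))
      (LinearMap.coprod ((tr) ∘ₗ (LinearMap.mulRight (ZMod 2) (σ w) +
        LinearMap.mulRight (ZMod 2) w ∘ₗ s)) 0)
  have hΦ : ∀ a t, Φ (a, t) =
      (κ * (σ a + a) + σ w * w * (σ t + t), tr (a * σ w + σ a * w)) := by
    intro a t
    simp [Φ, s, mul_assoc]
  suffices hmem : (σ w * w + κ, (1 : ZMod 2)) ∈ LinearMap.range Φ by
    obtain ⟨⟨a, t⟩, h⟩ := hmem
    rw [hΦ, Prod.mk.injEq] at h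
    exact ⟨a, t, h⟩
  by_contra hmem
  obtain ⟨φ, hφ, hle⟩ := Submodule.exists_le_ker_of_notMem hmem
  obtain ⟨p, hp⟩ := exists_trace_mul_eq_s12 (φ ∘ₗ LinearMap.inl (ZMod 2) K (ZMod 2))
  set ε := φ (0, 1)
  have hφe : ∀ x y, φ (x, y) = tr (p * x) + y * ε := by
    intro x y
    have : (x, y) = LinearMap.inl (ZMod 2) K (ZMod 2) x + y • ((0, 1) : K × ZMod 2) := by simp
    rw [this, map_add, map_smul, ← hp x]
    rfl
  have hker : ∀ a t, tr (p * (κ * (σ a + a) + σ w * w * (σ t + t))) +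
      tr (a * σ w + σ a * w) * ε = 0 := by
    intro a t
    rw [← hφe, ← hΦ]
    exact hle ⟨_, rfl⟩
  rw [hφe, one_mul] at hφ
  obtain ⟨k, hk⟩ : ∃ k, k = p * (σ w * w) := ⟨_, rfl⟩
  have hpk : p = k / (σ w * w) := by
    rw [hk]
    field_simp
  have hkfix : σ k = k := by
    have : k + σ k = 0 := by
      refine eq_zero_of_trace_mul_apply_eq_zero (σ := σ) fun t => ?_
      have h := hker 0 t
      simp only [map_zero, add_zero, mul_zero, zero_add, zero_mul] at h
      rw [← mul_assoc, ← hk, mul_add, map_add,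
        ← Algebra.trace_eq_of_algEquiv σ (k * t), ← map_add, map_mul σ, ← add_mul] at h
      exact h
    grind
  have hrel : κ * (p + σ p) + algebraMap (ZMod 2) K ε * (σ (σ w) + w) = 0 := by
    refine eq_zero_of_trace_mul_apply_eq_zero (σ := σ) fun a => ?_
    have h := hker a 0
    simp only [map_zero, add_zero, mul_zero] at h
    have e1 : tr (p * (κ * a)) = tr (σ p * (κ * σ a)) := by
      rw [← Algebra.trace_eq_of_algEquiv σ (p * (κ * a)), map_mul σ, map_mul σ, hκ]
    have e2 : tr (a * σ w) = tr (σ a * σ (σ w)) := by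
      rw [← Algebra.trace_eq_of_algEquiv σ (a * σ w), map_mul σ]
    have e3 : tr (algebraMap (ZMod 2) K ε * (σ a * σ (σ w) + σ a * w)) =
        ε * tr (σ a * σ (σ w) + σ a * w) := by
      rw [← Algebra.smul_def, map_smul, smul_eq_mul]
    have : (κ * (p + σ p) + algebraMap (ZMod 2) K ε * (σ (σ w) + w)) * σ a =
        p * (κ * σ a) + σ p * (κ * σ a) +
          algebraMap (ZMod 2) K ε * (σ a * σ (σ w) + σ a * w) := by ring
    rw [this, map_add, map_add, e3, ← e1, map_add, ← e2]
    rw [mul_add, mul_add, map_add, map_add] at h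
    linear_combination h
  have hsum : σ (σ w) + w ≠ 0 := fun h => hw (hfix w (by grind))
  have hN : κ * k = algebraMap (ZMod 2) K ε * (w * σ w * σ (σ w)) := by
    rw [hpk, map_div₀, map_mul, hkfix] at hrel
    field_simp at hrel
    refine mul_right_cancel₀ hsum ?_
    grind
  have hε : ε = 0 ∨ ε = 1 := by
    generalize ε = e
    revert e
    decide
  rcases hε with h0 | h0
  · rw [h0, map_zero, zero_mul] at hN
    have hk0 : k = 0 := (mul_eq_zero.1 hN).resolve_left hκ0
    simp [hpk, hk0, h0] at hφ
  · rw [h0, map_one, one_mul] at hN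
    refine hobs ⟨by rw [← hN, map_mul, hκ, hkfix], ?_⟩
    have e1 : p * (σ w * w + κ) = w * σ w * σ (σ w) / κ + σ (σ w) := by
      rw [mul_add, ← hk, ← hN, hpk]
      field_simp
      linear_combination hN
    rw [e1, map_add, Algebra.trace_eq_of_algEquiv, Algebra.trace_eq_of_algEquiv, ← map_add,
      h0] at hφ
    revert hφ
    generalize tr (w * σ w * σ (σ w) / κ + w) = e
    revert e
    decide

lemma exists_collision_of_fixed [Finite K] [CharP K 2]
    (hfix : ∀ x, σ (σ x) = x → σ x = x)
    (h1 : tr 1 = 0) {c : K} (hσc : σ c = c) (hc0 : c ≠ 0) (hc1 : c ≠ 1) (hne : ∃ w, σ w ≠ w) :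
    ∃ a, σ a ≠ a ∧ ∃ x y, x ≠ y ∧
      σ (traceShift σ (x + a)) * traceShift σ (x + a) +
        c * (σ (traceShift σ x) * traceShift σ x) =
      σ (traceShift σ (y + a)) * traceShift σ (y + a) +
        c * (σ (traceShift σ y) * traceShift σ y) := by
  have hc : 1 + c ≠ 0 := fun h => hc1 (by grind)
  obtain ⟨κ, hκdef⟩ : ∃ κ, κ = c / (1 + c) ^ 2 := ⟨_, rfl⟩
  have hκ : σ κ = κ := by simp [hκdef, hσc]
  have hκ0 : κ ≠ 0 := by
    rw [hκdef]
    positivity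
  obtain ⟨w, hw, hobs⟩ := exists_unobstructed hfix h1 hσc hc0 hc1 hκ hκ0 hne
  obtain ⟨a, t, hat, h_polar_w⟩ := exists_linear_system_solution hfix hκ hκ0 hw hobs
  have hlin : ∀ x y, tr (a * σ (x + y) + σ a * (x + y)) =
      tr (a * σ x + σ a * x) + tr (a * σ y + σ a * y) := by
    intro x y
    rw [← map_add, map_add σ]
    congr 1
    ring
  obtain ⟨u, v, hu, hv, huv⟩ : ∃ u v, tr (a * σ u + σ a * u) = 0 ∧ tr (a * σ v + σ a * v) = 1 ∧
      σ u * u + σ v * v = κ * (σ a + a + 1) := by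
    have hsum : σ (w * t) * (w * t) + σ (w * t + w) * (w * t + w) = κ * (σ a + a + 1) := by
      simp only [map_add, map_mul]
      grind
    have hval : ∀ e : ZMod 2, e = 0 ∨ e = 1 := by decide
    rcases hval (tr (a * σ (w * t) + σ a * (w * t))) with h | h
    · exact ⟨w * t, w * t + w, h, by rw [hlin, h, h_polar_w, zero_add], hsum⟩
    · exact ⟨w * t + w, w * t, by rw [hlin, h, h_polar_w]; decide, h, by rw [add_comm, hsum]⟩
  have hafix : σ a ≠ a := fun h => by
    rw [trace_polar_fixed h] at h_polar_w
    exact zero_ne_one h_polar_w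
  have hcinv : σ (1 / (1 + c)) = 1 / (1 + c) := by simp [hσc]
  have h_polar_div : tr (a * σ (a / (1 + c)) + σ a * (a / (1 + c))) = 0 := by
    rw [div_eq_mul_one_div a, map_mul, hcinv, mul_left_comm, CharTwo.add_self_eq_zero, map_zero]
  have h_polar_inv : tr (a * σ (1 / (1 + c)) + σ a * (1 / (1 + c))) = 0 :=
    trace_polar_fixed_right hcinv a
  have hA : ∀ y, traceShift σ (traceShift σ y + traceShift σ a) =
      y + a + algebraMap (ZMod 2) K (tr (a * σ y + σ a * y)) := by
    intro y
    rw [traceShift_add, traceShift_traceShift h1, traceShift_traceShift h1,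
      trace_polar_traceShift]
  have hy : tr (a * σ (u + a / (1 + c)) + σ a * (u + a / (1 + c))) = 0 := by
    rw [hlin, hu, h_polar_div, add_zero]
  have hz : tr (a * σ (v + a / (1 + c) + 1 / (1 + c)) +
      σ a * (v + a / (1 + c) + 1 / (1 + c))) = 1 := by
    rw [hlin, hlin, hv, h_polar_div, h_polar_inv, add_zero, add_zero]
  refine ⟨traceShift σ a, ?_, traceShift σ (u + a / (1 + c)),
    traceShift σ (v + a / (1 + c) + 1 / (1 + c)), ?_, ?_⟩
  · simpa [traceShift] using hafix
  · intro h
    have := congrArg (traceShift σ) h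
    rw [traceShift_traceShift h1, traceShift_traceShift h1] at this
    rw [← this, hy] at hz
    exact zero_ne_one hz
  · rw [hA, hA, traceShift_traceShift h1, traceShift_traceShift h1, hy, hz, map_zero, map_one,
      add_zero, add_assoc (v + a / (1 + c) + 1 / (1 + c)),
      apply_mul_add_const_mul hσc hc1, apply_mul_add_const_mul hσc hc1 _ (a + 1)]
    have hu' : u + a / (1 + c) + a / (1 + c) = u := by grind
    have hv' : v + a / (1 + c) + 1 / (1 + c) + (a + 1) / (1 + c) = v := by
      rw [add_div]
      grind
    rw [hu', hv']
    have hκ' : (1 + c) * κ = c / (1 + c) := by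
      rw [hκdef]
      field_simp
    simp only [map_add, map_one]
    linear_combination (1 + c) * huv + (σ a + a + 1) * hκ' -
      (1 + c) * (σ v * v) * CharTwo.two_eq_zero (R := K)

end Gold

section Frobenius

open FiniteField

lemma pow_two_pow_gcd_eq_self_s12 {K : Type*} [Field K] {x : K} {m k : ℕ}
    (hm : x ^ 2 ^ m = x) (hk : x ^ 2 ^ k = x) : x ^ 2 ^ Nat.gcd m k = x := by
  have iter : ∀ j : ℕ, (fun y : K => y ^ 2)^[j] x = x ^ 2 ^ j := fun j => by
    rw [pow_iterate]
  have := Function.IsPeriodicPt.gcd (f := fun y : K => y ^ 2) (x := x) (m := m) (n := k)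
    ((iter m).trans hm) ((iter k).trans hk)
  exact (iter _).symm.trans this

lemma pow_two_pow_eq_self_of_dvd_s12 {K : Type*} [Field K] {x : K} {m k : ℕ}
    (hm : x ^ 2 ^ m = x) (h : m ∣ k) : x ^ 2 ^ k = x := by
  have iter : ∀ j : ℕ, (fun y : K => y ^ 2)^[j] x = x ^ 2 ^ j := fun j => by
    rw [pow_iterate]
  have := Function.IsPeriodicPt.trans_dvd (f := fun y : K => y ^ 2) (x := x)
    ((iter m).trans hm) h
  exact (iter _).symm.trans this

lemma algebraMap_trace_eq_aTr {n : ℕ} (hn : n ≠ 0) (x : GaloisField 2 n) :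
    algebraMap (ZMod 2) (GaloisField 2 n) (Algebra.trace (ZMod 2) (GaloisField 2 n) x) =
      aTr n x := by
  rw [algebraMap_trace_eq_sum_pow, GaloisField.finrank 2 hn, Nat.card_zmod, aTr]

lemma pow_two_pow_eq_self {n : ℕ} (hn : n ≠ 0) (x : GaloisField 2 n) : x ^ 2 ^ n = x := by
  have := Fintype.ofFinite (GaloisField 2 n)
  rw [← GaloisField.card 2 n hn, Nat.card_eq_fintype_card, FiniteField.pow_card]

lemma exists_pow_two_pow_ne_self_s12 {n d : ℕ} (hdn : d < n) (hd : d ≠ 0) :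
    ∃ w : GaloisField 2 n, w ^ 2 ^ d ≠ w := by
  by_contra! H
  have := Fintype.ofFinite (GaloisField 2 n)
  have hdeg := FiniteField.X_pow_card_pow_sub_X_natDegree_eq (GaloisField 2 n) hd one_lt_two
  have hne := FiniteField.X_pow_card_pow_sub_X_ne_zero (GaloisField 2 n) hd one_lt_two
  have hle := Polynomial.card_le_degree_of_subset_roots
    (p := (Polynomial.X ^ 2 ^ d - Polynomial.X : Polynomial (GaloisField 2 n)))
    (Z := Finset.univ) (fun x _ => by simp [Polynomial.mem_roots hne, H x])
  rw [hdeg, Finset.card_univ, ← Nat.card_eq_fintype_card,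
    GaloisField.card 2 n (by lia)] at hle
  exact absurd hle (not_le.2 (Nat.pow_lt_pow_right one_lt_two hdn))

end Frobenius

/-- with `c ∈ F_{2^d} \ F_2`, `d = gcd(2i,n) = gcd(i,n) < n` and `n`
even: (i) for `a ∈ F_{2^d}` the equation `G(x+a) + c·G(x) = b` has a unique
solution for every `b`; (ii) there exist `a ∉ F_{2^d}` and `b` for which it has
at least two solutions. -/
theorem stmt12 (n i d : ℕ) (hne : Even n)
    (hd2 : d = Nat.gcd (2 * i) n) (hd1 : d = Nat.gcd i n) (hdn : d < n)
    (c : GaloisField 2 n) (hc : c ^ 2 ^ d = c) (hc0 : c ≠ 0) (hc1 : c ≠ 1) :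
    (∀ a b : GaloisField 2 n, a ^ 2 ^ d = a →
      ∃! x : GaloisField 2 n, Gfun n i (x + a) + c * Gfun n i x = b) ∧
    (∃ a b : GaloisField 2 n, ¬(a ^ 2 ^ d = a) ∧
      ∃ x y : GaloisField 2 n, x ≠ y ∧
        Gfun n i (x + a) + c * Gfun n i x = b ∧
        Gfun n i (y + a) + c * Gfun n i y = b) := by
  have hn : n ≠ 0 := by lia
  have hd : d ≠ 0 := by
    rintro rfl
    exact hn (Nat.eq_zero_of_gcd_eq_zero_right hd1.symm)
  let σ : GaloisField 2 n ≃ₐ[ZMod 2] GaloisField 2 n :=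
    FiniteField.frobeniusAlgEquivOfAlgebraic (ZMod 2) (GaloisField 2 n) ^ i
  have hσ : ∀ x, σ x = x ^ 2 ^ i := by
    intro x
    simp only [σ, AlgEquiv.coe_pow, FiniteField.coe_frobeniusAlgEquivOfAlgebraic_iterate,
      ZMod.card]
  have fixed_iff : ∀ x, σ x = x ↔ x ^ 2 ^ d = x := by
    intro x
    rw [hσ]
    refine ⟨fun h => ?_, fun h => pow_two_pow_eq_self_of_dvd_s12 h (hd1 ▸ Nat.gcd_dvd_left i n)⟩
    rw [hd1]
    exact pow_two_pow_gcd_eq_self_s12 h (pow_two_pow_eq_self hn x)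
  have hfix : ∀ x, σ (σ x) = x → σ x = x := by
    intro x h
    rw [fixed_iff, hd2]
    refine pow_two_pow_gcd_eq_self_s12 ?_ (pow_two_pow_eq_self hn x)
    rwa [hσ, hσ, ← pow_mul, ← pow_add, ← two_mul] at h
  have htr1 : Algebra.trace (ZMod 2) (GaloisField 2 n) 1 = 0 := by
    refine (algebraMap (ZMod 2) (GaloisField 2 n)).injective ?_
    rw [algebraMap_trace_eq_aTr hn, map_zero, aTr]
    simp only [one_pow, Finset.sum_const, Finset.card_range, nsmul_eq_mul, mul_one]
    exact (CharP.cast_eq_zero_iff _ 2 n).2 hne.two_dvd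
  have hG : ∀ x, Gfun n i x = σ (traceShift σ x) * traceShift σ x := by
    intro x
    rw [Gfun, traceShift, algebraMap_trace_eq_aTr hn, hσ, hσ, ← pow_succ, ← pow_succ]
  have hσc : σ c = c := (fixed_iff c).2 hc
  simp only [hG]
  refine ⟨fun a b ha => ?_, ?_⟩
  · exact (bijective_of_fixed hfix htr1 hσc hc1 ((fixed_iff a).2 ha)).existsUnique b
  · obtain ⟨w, hw⟩ := exists_pow_two_pow_ne_self_s12 hdn hd
    obtain ⟨a, ha, x, y, hxy, h⟩ := exists_collision_of_fixed hfix htr1 hσc hc0 hc1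
      ⟨w, fun h => hw ((fixed_iff w).1 h)⟩
    exact ⟨a, _, fun h => ha ((fixed_iff a).2 h), x, y, hxy, h, rfl⟩
end
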